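/- Let U = [−L/2, L/2]^d be the flat torus, D ∈ W^{2,∞}(U), and κ > 0. Let ρ = ρ(t,x) be a classical solution of the homogeneous McKean–Vlasov equation ∂t ρ = κ div_x(ρ (∇_x D ⋆ ρ)) + Δ_x ρ, i.e. ρ ∈ C¹((0,∞); C²(U)), ρ(t,·) is a strictly positive probability density on U for each t > 0, and the initial relative entropy H(ρ(0)|ρ∞) is finite. If κ < 2π²/(L² ‖Δ_x D‖_{L^∞(U)}), then for all t ≥ 0: H(ρ(t)|ρ∞) ≤ e^{−α t} H(ρ(0)|ρ∞), where α := 4π²/L² − 2κ ‖Δ_x D‖_{L^∞(U)} > 0. -/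

import Mathlib

open MeasureTheory Real

noncomputable section

/-- The fundamental domain `[-L/2, L/2]^d` of the flat torus of side length `L`. -/
def box (L : ℝ) (d : ℕ) : Set (Fin d → ℝ) :=
  Set.Icc (fun _ => -(L / 2)) (fun _ => L / 2)

/-- Partial derivative in the `i`-th coordinate direction. -/
def pd {d : ℕ} (i : Fin d) (f : (Fin d → ℝ) → ℝ) (x : Fin d → ℝ) : ℝ :=
  fderiv ℝ f x (Pi.single i 1)

/-- Laplacian. -/
def lap {d : ℕ} (f : (Fin d → ℝ) → ℝ) (x : Fin d → ℝ) : ℝ :=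
  ∑ i, pd i (pd i f) x

/-- Divergence of a vector field. -/
def divg {d : ℕ} (F : (Fin d → ℝ) → Fin d → ℝ) (x : Fin d → ℝ) : ℝ :=
  ∑ i, pd i (fun y => F y i) x

/-- `L`-periodicity in each coordinate (i.e. `f` is a function on the flat torus). -/
def Per {d : ℕ} (L : ℝ) (f : (Fin d → ℝ) → ℝ) : Prop :=
  ∀ (x : Fin d → ℝ) (i : Fin d), f (x + L • (Pi.single i 1 : Fin d → ℝ)) = f x

/-- Convolution on the torus: `(f ⋆ g)(x) = ∫_U f(x-y) g(y) dy`. -/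
def conv {d : ℕ} (L : ℝ) (f g : (Fin d → ℝ) → ℝ) (x : Fin d → ℝ) : ℝ :=
  ∫ y in box L d, f (x - y) * g y

/-- Relative entropy with respect to the splay state `ρ∞ = 1 / L^d`. -/
def relEnt {d : ℕ} (L : ℝ) (ρ : (Fin d → ℝ) → ℝ) : ℝ :=
  ∫ x in box L d, ρ x * Real.log (ρ x * L ^ d)

theorem ae_wirtinger {L : ℝ} (hL : 0 < L) (f f' : ℝ → ℝ) (hf : ∀ x, HasDerivAt f (f' x) x)
    (hf' : Continuous f') (hper : f L = f 0) (hmean : ∫ x in (0:ℝ)..L, f x = 0) :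
    ∫ x in (0:ℝ)..L, f x ^ 2 ≤ (L / (2 * π)) ^ 2 * ∫ x in (0:ℝ)..L, f' x ^ 2 := by
  have hfc : Continuous f := continuous_iff_continuousAt.2 fun x => (hf x).continuousAt
  have memlp : ∀ g : ℝ → ℝ, Continuous g →
      MemLp (fun x => (g x : ℂ)) 2 (volume.restrict (Set.Ioc 0 L)) := by
    intro g hg
    have h1 : Continuous fun x => (g x : ℂ) := Complex.continuous_ofReal.comp hg
    obtain ⟨C, hC⟩ := (isCompact_Icc (a := (0:ℝ)) (b := L)).exists_bound_of_continuousOn h1.continuousOn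
    refine MemLp.of_bound h1.aestronglyMeasurable C ?_
    filter_upwards [ae_restrict_mem measurableSet_Ioc] with x hx
    exact hC x (Set.Ioc_subset_Icc_self hx)
  have s1 := hasSum_sq_fourierCoeffOn hL (memlp f hfc)
  have s2 := hasSum_sq_fourierCoeffOn hL (memlp f' hf')
  have hle : ∀ n : ℤ, ‖fourierCoeffOn hL (fun x => (f x : ℂ)) n‖ ^ 2 ≤
      (L / (2 * π)) ^ 2 * ‖fourierCoeffOn hL (fun x => (f' x : ℂ)) n‖ ^ 2 := by
    intro n
    by_cases hn : n = 0
    · subst hn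
      have : fourierCoeffOn hL (fun x => (f x : ℂ)) 0 = 0 := by
        rw [fourierCoeffOn_eq_integral]
        simp only [neg_zero, fourier_zero, one_smul]
        rw [intervalIntegral.integral_ofReal, hmean]; simp
      rw [this]; simp; positivity
    · rw [fourierCoeffOn_of_hasDerivAt hL hn (f' := fun x => (f' x : ℂ))
        (fun x _ => (hf x).ofReal_comp)
        ((Complex.continuous_ofReal.comp hf').intervalIntegrable _ _)]
      have hn1 : (1:ℝ) ≤ |(n:ℝ)| := by
        rw [← Int.cast_abs]; exact_mod_cast Int.one_le_abs hn
      rw [hper]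
      simp only [sub_self, mul_zero, zero_sub, sub_zero, Complex.ofReal_zero]
      have e : ‖(1 / (-2 * (π:ℂ) * Complex.I * (n:ℂ)) *
          -((L:ℂ) * fourierCoeffOn hL (fun x => (f' x : ℂ)) n))‖ =
          (L / (2 * π)) * ‖fourierCoeffOn hL (fun x => (f' x : ℂ)) n‖ / |(n:ℝ)| := by
        simp [abs_of_pos hL, abs_of_pos pi_pos]
        field_simp
      rw [e]
      rw [← mul_pow]
      gcongr
      exact div_le_self (by positivity) hn1
  have := hasSum_le hle s1 (s2.mul_left _)
  simp only [Complex.norm_real, Real.norm_eq_abs, sq_abs, sub_zero, smul_eq_mul] at this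
  have h3 := mul_le_mul_of_nonneg_left this hL.le
  field_simp at h3 ⊢
  linarith

theorem ae_log7 : Real.log 7 < 1.9545 := by
  have h : Real.log 7 = 3 * Real.log 2 + Real.log (7 / 8) := by
    rw [Real.log_div (by norm_num) (by norm_num), show (8:ℝ) = 2 ^ 3 by norm_num, Real.log_pow]
    push_cast; ring
  have h2 := Real.log_two_lt_d9
  have h3 := Real.log_le_sub_one_of_pos (show (0:ℝ) < 7 / 8 by norm_num)
  linarith

theorem ae_logbound {y : ℝ} (hy : 0 < y) (hy7 : y ≤ 7) :
    2 * y ^ 2 * Real.log y ≤ (5 * y - 3) * (y - 1) := by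
  let q : ℝ → ℝ := fun y => (5 - 8 / y + 3 / y ^ 2) / 2 - Real.log y
  have hq : ∀ y : ℝ, 0 < y → HasDerivAt q (-((y - 1) * (y - 3)) / y ^ 3) y := by
    intro y hy
    have h1 : HasDerivAt (fun y : ℝ => (5 - 8 / y + 3 / y ^ 2) / 2 - Real.log y)
      (((0 - (0 * y - 8 * 1) / y ^ 2) + (0 * y ^ 2 - 3 * (((2:ℕ):ℝ) * y ^ (2-1) * 1)) / (y ^ 2) ^ 2) / 2 - y⁻¹) y := by
      have hid := hasDerivAt_id' y
      exact (((((hasDerivAt_const y (5:ℝ)).sub ((hasDerivAt_const y (8:ℝ)).div hid hy.ne'))).add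
        ((hasDerivAt_const y (3:ℝ)).div (hid.pow 2) (pow_ne_zero 2 hy.ne'))).div_const 2).sub
        (Real.hasDerivAt_log hy.ne')
    convert h1 using 1
    field_simp
    push_cast
    ring
  have q1 : q 1 = 0 := by simp [q]; norm_num
  have q7 : 0 ≤ q 7 := by have := ae_log7; simp only [q]; linarith
  have hcont : ∀ s : Set ℝ, (∀ x ∈ s, 0 < x) → ContinuousOn q s := fun s hs x hx =>
    (hq x (hs x hx)).continuousAt.continuousWithinAt
  have hmain : 0 ≤ q y := by
    rcases le_total y 1 with h | h
    · have : AntitoneOn q (Set.Icc y 1) := by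
        apply antitoneOn_of_deriv_nonpos (convex_Icc _ _) (hcont _ fun x hx => hy.trans_le hx.1)
        · intro x hx; rw [interior_Icc] at hx
          exact (hq x (hy.trans hx.1)).differentiableAt.differentiableWithinAt
        · intro x hx; rw [interior_Icc] at hx
          have h0 := hy.trans hx.1
          rw [(hq x h0).deriv]
          apply div_nonpos_of_nonpos_of_nonneg _ (by positivity)
          nlinarith [hx.2]
      have := this (Set.left_mem_Icc.2 h) (Set.right_mem_Icc.2 h) h
      linarith
    · rcases le_total y 3 with h' | h'
      · have : MonotoneOn q (Set.Icc 1 y) := by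
          apply monotoneOn_of_deriv_nonneg (convex_Icc _ _) (hcont _ fun x hx => by linarith [hx.1])
          · intro x hx; rw [interior_Icc] at hx
            exact (hq x (by linarith [hx.1])).differentiableAt.differentiableWithinAt
          · intro x hx; rw [interior_Icc] at hx
            have h0 : 0 < x := by linarith [hx.1]
            rw [(hq x h0).deriv]
            apply div_nonneg _ (by positivity)
            nlinarith [hx.2, hx.1]
        have := this (Set.left_mem_Icc.2 h) (Set.right_mem_Icc.2 h) h
        linarith
      · have : AntitoneOn q (Set.Icc y 7) := by
          apply antitoneOn_of_deriv_nonpos (convex_Icc _ _) (hcont _ fun x hx => hy.trans_le hx.1)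
          · intro x hx; rw [interior_Icc] at hx
            exact (hq x (hy.trans hx.1)).differentiableAt.differentiableWithinAt
          · intro x hx; rw [interior_Icc] at hx
            have h0 := hy.trans hx.1
            rw [(hq x h0).deriv]
            apply div_nonpos_of_nonpos_of_nonneg _ (by positivity)
            nlinarith [hx.2, hx.1]
        have := this (Set.left_mem_Icc.2 hy7) (Set.right_mem_Icc.2 hy7) hy7
        linarith
  have h5 : 0 ≤ 2 * y ^ 2 * q y := by positivity
  have h6 : 2 * y ^ 2 * q y = (5 * y - 3) * (y - 1) - 2 * y ^ 2 * Real.log y := by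
    simp only [q]; field_simp; ring
  linarith

theorem ae_tv {L : ℝ} (f f' : ℝ → ℝ) (hf : ∀ x, HasDerivAt f (f' x) x)
    (hf' : Continuous f') (hper : f L = f 0) {p q : ℝ} (hp : 0 ≤ p) (hpq : p ≤ q) (hq : q ≤ L) :
    2 * |f q - f p| ≤ ∫ x in (0:ℝ)..L, |f' x| := by
  have ii : ∀ a b, IntervalIntegrable f' volume a b := fun a b => hf'.intervalIntegrable a b
  have ia : ∀ a b, IntervalIntegrable (fun x => |f' x|) volume a b :=
    fun a b => hf'.abs.intervalIntegrable a b
  have ftc : ∀ a b, ∫ x in a..b, f' x = f b - f a := fun a b =>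
    intervalIntegral.integral_eq_sub_of_hasDerivAt (fun x _ => hf x) (ii a b)
  have ab : ∀ a b, a ≤ b → |f b - f a| ≤ ∫ x in a..b, |f' x| := fun a b h => by
    rw [← ftc]; exact intervalIntegral.abs_integral_le_integral_abs h
  have e1 := intervalIntegral.integral_add_adjacent_intervals (ia 0 p) (ia p q)
  have e2 := intervalIntegral.integral_add_adjacent_intervals (ia 0 q) (ia q L)
  have h1 := ab 0 p hp
  have h2 := ab p q hpq
  have h3 := ab q L hq
  rw [hper] at h3
  have h4 : |f q - f p| ≤ |f p - f 0| + |f 0 - f q| := by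
    have := abs_add_le (f p - f 0) (f 0 - f q)
    have e : f p - f q = (f p - f 0) + (f 0 - f q) := by ring
    rw [abs_sub_comm (f q), e]; exact this
  linarith

theorem ae_tv' {L : ℝ} (f f' : ℝ → ℝ) (hf : ∀ x, HasDerivAt f (f' x) x)
    (hf' : Continuous f') (hper : f L = f 0) {p q : ℝ} (hp : p ∈ Set.Icc 0 L) (hq : q ∈ Set.Icc 0 L) :
    2 * (f q - f p) ≤ ∫ x in (0:ℝ)..L, |f' x| := by
  rcases le_total p q with h | h
  · exact le_trans (by gcongr; exact le_abs_self _) (ae_tv f f' hf hf' hper hp.1 h hq.2)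
  · refine le_trans ?_ (ae_tv f f' hf hf' hper hq.1 h hp.2)
    rw [abs_sub_comm]; gcongr; exact le_abs_self _

theorem ae_lsi1 {L : ℝ} (hL : 0 < L) (g g' : ℝ → ℝ) (hg : ∀ x, HasDerivAt g (g' x) x)
    (hg' : Continuous g') (hper : g L = g 0) (hpos : ∀ x, 0 < g x) (m : ℝ)
    (hm : L * m = ∫ x in (0:ℝ)..L, g x) :
    ∫ x in (0:ℝ)..L, g x * Real.log (g x / m) ≤
      (L / (2 * π)) ^ 2 * ∫ x in (0:ℝ)..L, g' x ^ 2 / g x := by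
  have hgc : Continuous g := continuous_iff_continuousAt.2 fun x => (hg x).continuousAt
  set f : ℝ → ℝ := fun x => √(g x) with hfdef
  set f' : ℝ → ℝ := fun x => g' x / (2 * √(g x)) with hf'def
  have fpos : ∀ x, 0 < f x := fun x => Real.sqrt_pos.2 (hpos x)
  have hf : ∀ x, HasDerivAt f (f' x) x := fun x => (hg x).sqrt (hpos x).ne'
  have hfc : Continuous f := hgc.sqrt
  have hf' : Continuous f' := hg'.div (continuous_const.mul hfc) fun x => by
    have := fpos x; positivity
  have hfg : ∀ x, f x ^ 2 = g x := fun x => Real.sq_sqrt (hpos x).le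
  have hfper : f L = f 0 := by simp [f, hper]
  have hd : ∀ x, g' x ^ 2 / g x = 4 * f' x ^ 2 := by
    intro x
    have h1 := fpos x
    have : f' x = g' x / (2 * f x) := rfl
    rw [this, ← hfg x]; field_simp; norm_num
  simp_rw [hd]
  rw [intervalIntegral.integral_const_mul]
  have ig : ∀ h : ℝ → ℝ, Continuous h → IntervalIntegrable h volume 0 L :=
    fun h hh => hh.intervalIntegrable _ _
  have hmpos : 0 < m := by
    have : 0 < ∫ x in (0:ℝ)..L, g x :=
      intervalIntegral.intervalIntegral_pos_of_pos_on (ig g hgc) (fun x _ => hpos x) hL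
    rw [← hm] at this
    exact pos_of_mul_pos_right this hL.le
  obtain ⟨a, ha⟩ : ∃ a, L * a = ∫ x in (0:ℝ)..L, f x := ⟨(∫ x in (0:ℝ)..L, f x) / L, by field_simp⟩
  have hapos : 0 < a := by
    have : 0 < ∫ x in (0:ℝ)..L, f x :=
      intervalIntegral.intervalIntegral_pos_of_pos_on (ig f hfc) (fun x _ => fpos x) hL
    rw [← ha] at this
    exact pos_of_mul_pos_right this hL.le
  have clog : ∀ c : ℝ, 0 < c → Continuous fun x => g x * Real.log (g x / c) := fun c hc =>
    hgc.mul ((hgc.div_const c).log fun x => (div_pos (hpos x) hc).ne')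
  by_cases hcase : ∀ x ∈ Set.Icc 0 L, f x ≤ 7 * a
  · -- small oscillation
    have hw := ae_wirtinger hL (fun x => f x - a) f' (fun x => (hf x).sub_const a) hf'
      (by simp [hfper]) (by
        rw [intervalIntegral.integral_sub (ig f hfc) (ig _ continuous_const), ← ha]; simp)
    have h1 : ∫ x in (0:ℝ)..L, g x * Real.log (g x / m) ≤
        ∫ x in (0:ℝ)..L, (g x * Real.log (a ^ 2 / m) + (g x - a ^ 2) + 4 * (f x - a) ^ 2) := by
      apply intervalIntegral.integral_mono_on hL.le (ig _ (clog m hmpos)) (ig _ (by fun_prop))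
      intro x hx
      have hy := ae_logbound (div_pos (fpos x) hapos) (by
        rw [div_le_iff₀ hapos]; exact hcase x hx)
      have e1 : Real.log (g x / m) = Real.log (a ^ 2 / m) + 2 * Real.log (f x / a) := by
        have h1 := fpos x
        rw [← hfg x, Real.log_div (by positivity) (by positivity),
          Real.log_div (by positivity) (by positivity), Real.log_div (by positivity) (by positivity),
          Real.log_pow, Real.log_pow]
        push_cast; ring
      have e2 := mul_le_mul_of_nonneg_left hy (sq_nonneg a)
      have e3 : a ^ 2 * (2 * (f x / a) ^ 2 * Real.log (f x / a)) = 2 * g x * Real.log (f x / a) := by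
        rw [← hfg x]; field_simp
      have e4 : a ^ 2 * ((5 * (f x / a) - 3) * (f x / a - 1)) = (5 * f x - 3 * a) * (f x - a) := by
        field_simp
      rw [e3, e4] at e2
      have := hfg x
      rw [e1]
      nlinarith
    rw [intervalIntegral.integral_add (ig _ (by fun_prop)) (ig _ (by fun_prop)),
      intervalIntegral.integral_add (ig _ (by fun_prop)) (ig _ (by fun_prop)),
      intervalIntegral.integral_sub (ig _ (by fun_prop)) (ig _ (by fun_prop)),
      intervalIntegral.integral_mul_const, intervalIntegral.integral_const_mul, ← hm] at h1
    simp only [intervalIntegral.integral_const, sub_zero, smul_eq_mul] at h1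
    have h2 := Real.log_le_sub_one_of_pos (show 0 < a ^ 2 / m by positivity)
    have h3 : L * m * Real.log (a ^ 2 / m) ≤ L * (a ^ 2 - m) := by
      calc _ ≤ L * m * (a ^ 2 / m - 1) := by gcongr
        _ = _ := by field_simp
    linarith
  · push Not at hcase
    obtain ⟨x0, hx0, hx0'⟩ := hcase
    obtain ⟨x1, hx1, hmax⟩ := (isCompact_Icc (a := (0:ℝ)) (b := L)).exists_isMaxOn ⟨x0, hx0⟩ hfc.continuousOn
    set μ := f x1 with hμ
    have hmax' : ∀ x ∈ Set.Icc 0 L, f x ≤ μ := fun x hx => hmax hx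
    have hμ7 : 7 * a < μ := lt_of_lt_of_le hx0' (hmax' _ hx0)
    have hμpos : 0 < μ := fpos x1
    set V := ∫ x in (0:ℝ)..L, |f' x| with hV
    have hm2 : m ≤ μ * a := by
      have : ∫ x in (0:ℝ)..L, g x ≤ ∫ x in (0:ℝ)..L, μ * f x := by
        apply intervalIntegral.integral_mono_on hL.le (ig _ hgc) (ig _ (by fun_prop))
        intro x hx
        rw [← hfg x]
        nlinarith [hmax' x hx, fpos x]
      rw [intervalIntegral.integral_const_mul, ← hm, ← ha] at this
      have h2 : L * m ≤ L * (μ * a) := by linarith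
      exact le_of_mul_le_mul_left h2 hL
    have hVm : 2 * (μ - a) ≤ V := by
      have : ∫ x in (0:ℝ)..L, 2 * (μ - f x) ≤ ∫ x in (0:ℝ)..L, V := by
        apply intervalIntegral.integral_mono_on hL.le (ig _ (by fun_prop)) (ig _ (by fun_prop))
        intro x hx
        exact ae_tv' f f' hf hf' hfper hx hx1
      rw [intervalIntegral.integral_const_mul, intervalIntegral.integral_sub (ig _ (by fun_prop)) (ig _ hfc), ← ha] at this
      simp only [intervalIntegral.integral_const, sub_zero, smul_eq_mul] at this
      have h2 : L * (2 * (μ - a)) ≤ L * V := by linarith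
      exact le_of_mul_le_mul_left h2 hL
    have hVmu : 12 / 7 * μ ≤ V := by linarith
    have hCS : V ^ 2 ≤ L * ∫ x in (0:ℝ)..L, f' x ^ 2 := by
      have h0 : 0 ≤ ∫ x in (0:ℝ)..L, (|f' x| - V / L) ^ 2 :=
        intervalIntegral.integral_nonneg hL.le fun x _ => sq_nonneg _
      have e : ∀ x, (|f' x| - V / L) ^ 2 = f' x ^ 2 - 2 * (V / L) * |f' x| + (V / L) ^ 2 := by
        intro x; rw [← sq_abs (f' x)]; ring
      simp_rw [e] at h0
      rw [intervalIntegral.integral_add (ig _ (by fun_prop)) (ig _ (by fun_prop)),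
        intervalIntegral.integral_sub (ig _ (by fun_prop)) (ig _ (by fun_prop)),
        intervalIntegral.integral_const_mul, ← hV] at h0
      simp only [intervalIntegral.integral_const, sub_zero, smul_eq_mul] at h0
      have h2 := mul_nonneg hL.le h0
      have h3 : L * (((∫ x in (0:ℝ)..L, f' x ^ 2) - 2 * (V / L) * V) + L * (V / L) ^ 2) =
        L * (∫ x in (0:ℝ)..L, f' x ^ 2) - V ^ 2 := by field_simp; ring
      linarith
    have h1 : ∫ x in (0:ℝ)..L, g x * Real.log (g x / m) ≤
        ∫ x in (0:ℝ)..L, g x * Real.log (μ ^ 2 / m) := by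
      apply intervalIntegral.integral_mono_on hL.le (ig _ (clog m hmpos)) (ig _ (by fun_prop))
      intro x hx
      have := hpos x
      have h2 := fpos x
      have h3 := hmax' x hx
      gcongr
      rw [← hfg x]; gcongr
    rw [intervalIntegral.integral_mul_const, ← hm] at h1
    set z := μ ^ 2 / m with hz
    have hz7 : 7 ≤ z := by
      rw [hz, le_div_iff₀ hmpos]; nlinarith
    have hl7 := ae_log7
    have hl7' : 1 ≤ Real.log 7 := by
      rw [Real.le_log_iff_exp_le (by norm_num)]
      linarith [Real.exp_one_lt_d9]
    have hlz : Real.log z ≤ Real.log 7 * (z / 7) := by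
      have e : Real.log z = Real.log 7 + Real.log (z / 7) := by
        rw [← Real.log_mul (by norm_num) (by positivity)]; congr 1; ring
      have := Real.log_le_sub_one_of_pos (show 0 < z / 7 by positivity)
      nlinarith
    have h2 : L * m * Real.log z ≤ L * (Real.log 7 / 7) * μ ^ 2 := by
      calc _ ≤ L * m * (Real.log 7 * (z / 7)) := by gcongr
        _ = _ := by rw [hz]; field_simp
    have h3 : (12 / 7 * μ) ^ 2 ≤ L * ∫ x in (0:ℝ)..L, f' x ^ 2 :=
      le_trans (by gcongr) hCS
    have hpi : π ^ 2 < 9.9225 := by have := Real.pi_lt_d2; have := Real.pi_pos; nlinarith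
    have h4 : L * (Real.log 7 / 7) * μ ^ 2 ≤ L * (1 / π ^ 2) * (12 / 7 * μ) ^ 2 := by
      have : Real.log 7 / 7 ≤ 1 / π ^ 2 * (144 / 49) := by
        rw [div_mul_eq_mul_div, div_le_div_iff₀ (by norm_num) (by positivity)]
        nlinarith
      have h5 := mul_le_mul_of_nonneg_left this (show 0 ≤ L * μ ^ 2 by positivity)
      linarith
    calc _ ≤ L * (1 / π ^ 2) * (12 / 7 * μ) ^ 2 := by linarith
      _ ≤ L * (1 / π ^ 2) * (L * ∫ x in (0:ℝ)..L, f' x ^ 2) := by gcongr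
      _ = _ := by field_simp; norm_num

theorem tc_pd_contDiff {d : ℕ} {n m : WithTop ℕ∞} (i : Fin d) {f : (Fin d → ℝ) → ℝ} (hf : ContDiff ℝ n f)
    (h : m + 1 ≤ n) : ContDiff ℝ m (pd i f) := by
  have := hf.fderiv_right (m := m) h
  exact this.clm_apply contDiff_const

theorem tc_pd_cont {d : ℕ} (i : Fin d) {f : (Fin d → ℝ) → ℝ} (hf : ContDiff ℝ 1 f) :
    Continuous (pd i f) :=
  (tc_pd_contDiff (m := 0) i hf (by norm_num)).continuous

theorem tc_pd_c1 {d : ℕ} (i : Fin d) {f : (Fin d → ℝ) → ℝ} (hf : ContDiff ℝ 2 f) :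
    ContDiff ℝ 1 (pd i f) :=
  tc_pd_contDiff (m := 1) i hf (le_of_eq one_add_one_eq_two)

theorem tc_per_pd {d : ℕ} {L : ℝ} (i : Fin d) {f : (Fin d → ℝ) → ℝ} (hf : Per L f) : Per L (pd i f) := by
  intro x j
  unfold pd
  rw [← fderiv_comp_add_right]
  congr 2
  funext y
  exact hf y j

theorem tc_pd_mul {d : ℕ} (i : Fin d) {f g : (Fin d → ℝ) → ℝ} {x : Fin d → ℝ} (hf : DifferentiableAt ℝ f x)
    (hg : DifferentiableAt ℝ g x) :
    pd i (fun y => f y * g y) x = f x * pd i g x + g x * pd i f x := by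
  unfold pd
  rw [fderiv_fun_mul hf hg]; simp

theorem tc_pd_comp {d : ℕ} (i : Fin d) {h h' : ℝ → ℝ} {f : (Fin d → ℝ) → ℝ} {x : Fin d → ℝ}
    (hf : DifferentiableAt ℝ f x) (hh : HasDerivAt h (h' (f x)) (f x)) :
    pd i (fun y => h (f y)) x = h' (f x) * pd i f x := by
  unfold pd
  have := (hh.comp_hasFDerivAt x hf.hasFDerivAt).fderiv
  rw [show (fun y => h (f y)) = h ∘ f from rfl, this]; simp

/-- derivative along a coordinate line -/
theorem tc_line {d : ℕ} (i : Fin d) {f : (Fin d → ℝ) → ℝ} (hf : Differentiable ℝ f) (x : Fin d → ℝ) (s : ℝ) :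
    HasDerivAt (fun s : ℝ => f (x + s • (Pi.single i 1 : Fin d → ℝ)))
      (pd i f (x + s • (Pi.single i 1 : Fin d → ℝ))) s := by
  have h1 : HasDerivAt (fun s : ℝ => x + s • (Pi.single i 1 : Fin d → ℝ))
      (Pi.single i 1 : Fin d → ℝ) s := by
    simpa using ((hasDerivAt_id s).smul_const (Pi.single i 1 : Fin d → ℝ)).const_add x
  exact (hf _).hasFDerivAt.comp_hasDerivAt s h1

theorem tc_insert {n : ℕ} (i : Fin (n + 1)) (s r : ℝ) (y : Fin n → ℝ) :
    (Fin.insertNth i (s + r) y : Fin (n + 1) → ℝ) =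
      (Fin.insertNth i s y : Fin (n + 1) → ℝ) + r • (Pi.single i 1 : Fin (n + 1) → ℝ) := by
  funext j
  rcases Fin.eq_self_or_eq_succAbove i j with h | ⟨k, h⟩
  · subst h; simp
  · subst h; simp

theorem tc_box_compact (L : ℝ) (d : ℕ) : IsCompact (box L d) := isCompact_Icc
theorem tc_box_meas (L : ℝ) (d : ℕ) : MeasurableSet (box L d) := measurableSet_Icc

theorem tc_int {d : ℕ} (L : ℝ) {f : (Fin d → ℝ) → ℝ} (hf : Continuous f) : IntegrableOn f (box L d) :=
  hf.continuousOn.integrableOn_compact (tc_box_compact L d)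

theorem tc_fubini {n : ℕ} {L : ℝ} (hL : 0 < L) (i : Fin (n + 1)) {f : (Fin (n + 1) → ℝ) → ℝ} (hf : Continuous f) :
    ∫ x in box L (n + 1), f x =
      ∫ y in box L n, ∫ s in (-(L / 2))..(L / 2), f (Fin.insertNth i s y) := by
  have mp := volume_preserving_piFinSuccAbove (fun _ : Fin (n + 1) => ℝ) i
  let e := MeasurableEquiv.piFinSuccAbove (fun _ : Fin (n + 1) => ℝ) i
  have hpre : e ⁻¹' (Set.Icc (-(L / 2)) (L / 2) ×ˢ box L n) = box L (n + 1) := by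
    ext x
    simp only [box, Set.mem_preimage, Set.mem_prod, Set.mem_Icc, Pi.le_def]
    have : e x = (x i, fun j => x (i.succAbove j)) := rfl
    rw [this]
    simp only
    constructor
    · rintro ⟨⟨h1, h2⟩, h3, h4⟩
      constructor <;> intro j <;> rcases Fin.eq_self_or_eq_succAbove i j with h | ⟨k, h⟩ <;> subst h <;> simp_all
    · rintro ⟨h1, h2⟩
      exact ⟨⟨h1 i, h2 i⟩, fun j => h1 _, fun j => h2 _⟩
  have hsymm : ∀ p : ℝ × (Fin n → ℝ), e.symm p = Fin.insertNth i p.1 p.2 := fun p => rfl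
  have key := mp.setIntegral_preimage_emb e.measurableEmbedding (fun p => f (e.symm p))
    (Set.Icc (-(L / 2)) (L / 2) ×ˢ box L n)
  change ∫ x in e ⁻¹' (Set.Icc (-(L / 2)) (L / 2) ×ˢ box L n), f (e.symm (e x)) = _ at key
  rw [hpre] at key
  simp only [MeasurableEquiv.symm_apply_apply] at key
  rw [key]
  have hc : Continuous fun p : ℝ × (Fin n → ℝ) => f (e.symm p) := by
    apply hf.comp
    change Continuous fun p : ℝ × (Fin n → ℝ) => Fin.insertNth (α := fun _ => ℝ) i p.1 p.2
    exact Continuous.finInsertNth (A := fun _ => ℝ) i continuous_fst continuous_snd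
  rw [show (volume : Measure (ℝ × (Fin n → ℝ))) = volume.prod volume from rfl,
    ← setIntegral_prod_swap, setIntegral_prod]
  · apply setIntegral_congr_fun (tc_box_meas L n)
    intro y _
    simp only [Prod.swap_prod_mk, hsymm]
    rw [intervalIntegral.integral_of_le (by linarith), integral_Icc_eq_integral_Ioc]
  · exact (hc.comp continuous_swap).continuousOn.integrableOn_compact
      ((tc_box_compact L n).prod isCompact_Icc)

theorem tc_translate {d : ℕ} {L : ℝ} (hL : 0 < L) (i : Fin d) {f : (Fin d → ℝ) → ℝ} (hf : Continuous f)
    (hp : Per L f) (r : ℝ) :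
    ∫ x in box L d, f (x + r • (Pi.single i 1 : Fin d → ℝ)) = ∫ x in box L d, f x := by
  obtain _ | n := d
  · exact i.elim0
  rw [tc_fubini hL i hf, tc_fubini hL i (f := fun x => f (x + r • (Pi.single i 1 : Fin (n+1) → ℝ))) (by fun_prop)]
  apply setIntegral_congr_fun (tc_box_meas L n)
  intro y _
  simp only
  simp_rw [← tc_insert]
  have per : Function.Periodic (fun s => f (Fin.insertNth i s y)) L := by
    intro s
    simp only [tc_insert]; exact hp _ i
  rw [intervalIntegral.integral_comp_add_right (fun s => f (Fin.insertNth i s y))]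
  have := per.intervalIntegral_add_eq (-(L / 2) + r) (-(L/2))
  rw [show -(L / 2) + L = L / 2 by ring, show -(L / 2) + r + L = L / 2 + r by ring] at this
  exact this

theorem tc_int_pd {d : ℕ} {L : ℝ} (hL : 0 < L) (i : Fin d) {f : (Fin d → ℝ) → ℝ} (hf : ContDiff ℝ 1 f)
    (hp : Per L f) : ∫ x in box L d, pd i f x = 0 := by
  obtain _ | n := d
  · exact i.elim0
  rw [tc_fubini hL i (tc_pd_cont i hf)]
  apply integral_eq_zero_of_ae
  refine Filter.Eventually.of_forall fun y => ?_
  have e : ∀ s : ℝ, (Fin.insertNth i s y : Fin (n + 1) → ℝ) =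
      (Fin.insertNth i 0 y : Fin (n + 1) → ℝ) + s • (Pi.single i 1 : Fin (n + 1) → ℝ) := fun s => by
    rw [← tc_insert, zero_add]
  simp only [Pi.zero_apply]
  rw [show (fun s : ℝ => pd i f (Fin.insertNth i s y)) = fun s : ℝ => pd i f ((Fin.insertNth i 0 y : Fin (n + 1) → ℝ) + s • (Pi.single i 1 : Fin (n + 1) → ℝ)) from funext fun s => by rw [← e]]
  rw [intervalIntegral.integral_eq_sub_of_hasDerivAt
    (fun s _ => tc_line i (hf.differentiable one_ne_zero) _ s)
    (Continuous.intervalIntegrable ((tc_pd_cont i hf).comp (by fun_prop)) _ _)]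
  rw [sub_eq_zero, ← hp (_ + (-(L / 2)) • _) i, add_assoc, ← add_smul]
  congr 3; ring

theorem tc_reduce {d : ℕ} {L : ℝ} (hL : 0 < L) (x : Fin d → ℝ) :
    ∃ y ∈ box L d, ∀ f : (Fin d → ℝ) → ℝ, Per L f → f x = f y := by
  let n : Fin d → ℤ := fun i => - round (x i / L)
  refine ⟨x + ∑ i, n i • (L • (Pi.single i 1 : Fin d → ℝ)), ?_, ?_⟩
  · have : ∀ j, (x + ∑ i, n i • (L • (Pi.single i 1 : Fin d → ℝ))) j = x j - L * round (x j / L) := by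
      intro j
      simp [n, Finset.sum_apply, Pi.single_apply]
      ring
    have key : ∀ j, |x j - L * round (x j / L)| ≤ L / 2 := by
      intro j
      have h := abs_sub_round (x j / L)
      have : x j - L * round (x j / L) = L * (x j / L - round (x j / L)) := by field_simp
      rw [this, abs_mul, abs_of_pos hL]
      calc _ ≤ L * (1 / 2) := by gcongr
        _ = _ := by ring
    refine ⟨fun j => ?_, fun j => ?_⟩
    · rw [this]; exact (abs_le.1 (key j)).1
    · rw [this]; exact (abs_le.1 (key j)).2
  · intro f hf
    have : ∀ s : Finset (Fin d), Function.Periodic f (∑ i ∈ s, n i • (L • (Pi.single i 1 : Fin d → ℝ))) := by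
      intro s
      induction s using Finset.induction_on with
      | empty => intro x; simp
      | insert a s ha ih =>
        rw [Finset.sum_insert ha]
        have h1 : Function.Periodic f (L • (Pi.single a 1 : Fin d → ℝ)) := fun x => hf x a
        exact (h1.zsmul (n a)).add_period ih
    exact (this Finset.univ x).symm

theorem tc_bdd {d : ℕ} {L : ℝ} (hL : 0 < L) {f : (Fin d → ℝ) → ℝ} (hf : Continuous f) (hp : Per L f) :
    ∃ C, 0 ≤ C ∧ ∀ x, |f x| ≤ C := by
  obtain ⟨C, hC⟩ := (tc_box_compact L d).exists_bound_of_continuousOn hf.continuousOn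
  have h : ∀ x, |f x| ≤ C := by
    intro x
    obtain ⟨y, hy, hxy⟩ := tc_reduce hL x
    rw [hxy f hp]; exact hC y hy
  exact ⟨C, (abs_nonneg _).trans (h 0), h⟩

theorem tc_lb {d : ℕ} {L : ℝ} (hL : 0 < L) {f : (Fin d → ℝ) → ℝ} (hf : Continuous f) (hp : Per L f)
    (hpos : ∀ x, 0 < f x) : ∃ c, 0 < c ∧ ∀ x, c ≤ f x := by
  obtain ⟨z, hz, -⟩ := tc_reduce hL (0 : Fin d → ℝ)
  obtain ⟨x0, hx0, hmin⟩ := (tc_box_compact L d).exists_isMinOn ⟨z, hz⟩ hf.continuousOn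
  refine ⟨f x0, hpos x0, fun x => ?_⟩
  obtain ⟨y, hy, hxy⟩ := tc_reduce hL x
  rw [hxy f hp]; exact hmin hy

theorem tc_param {d : ℕ} {Y : Type*} [TopologicalSpace Y] [MeasurableSpace Y] [OpensMeasurableSpace Y]
    [T2Space Y] [SecondCountableTopology Y] {μ : Measure Y} [IsLocallyFiniteMeasure μ] {S : Set Y} (hS : IsCompact S)
    {f : (Fin d → ℝ) → ℝ} (hf : ContDiff ℝ 1 f) {w : Y → ℝ} (hw : Continuous w)
    {p : Y → (Fin d → ℝ)} (hp : Continuous p) :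
    ContDiff ℝ 1 (fun x => ∫ y in S, w y * f (x + p y) ∂μ) ∧
    ∀ i x, pd i (fun x => ∫ y in S, w y * f (x + p y) ∂μ) x = ∫ y in S, w y * pd i f (x + p y) ∂μ := by
  have hfd : Continuous (fderiv ℝ f) := hf.continuous_fderiv one_ne_zero
  have hjoint : Continuous (fun q : (Fin d → ℝ) × Y => w q.2 • fderiv ℝ f (q.1 + p q.2)) := by fun_prop
  have hint : ∀ x, IntegrableOn (fun y => w y • fderiv ℝ f (x + p y)) S μ := fun x =>
    (Continuous.continuousOn (by fun_prop)).integrableOn_compact hS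
  have hder : ∀ x0, HasFDerivAt (fun x => ∫ y in S, w y * f (x + p y) ∂μ)
      (∫ y in S, w y • fderiv ℝ f (x0 + p y) ∂μ) x0 := by
    intro x0
    obtain ⟨C, hC⟩ := ((isCompact_closedBall x0 1).prod hS).exists_bound_of_continuousOn hjoint.continuousOn
    have hfc := hf.continuous
    refine hasFDerivAt_integral_of_dominated_of_fderiv_le (bound := fun _ => C)
      (F' := fun x y => w y • fderiv ℝ f (x + p y)) (Metric.ball_mem_nhds x0 one_pos) ?_ ?_ ?_ ?_ ?_ ?_
    · exact Filter.Eventually.of_forall fun x => Continuous.aestronglyMeasurable (by fun_prop)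
    · exact (Continuous.continuousOn (by fun_prop)).integrableOn_compact hS
    · exact (hint x0).aestronglyMeasurable
    · filter_upwards [ae_restrict_mem hS.measurableSet] with y hy x hx
      exact hC (x, y) ⟨Metric.ball_subset_closedBall hx, hy⟩
    · have : IsFiniteMeasure (μ.restrict S) := ⟨by simpa using hS.measure_lt_top⟩
      exact integrable_const C
    · refine Filter.Eventually.of_forall fun y x hx => ?_
      have h1 : HasFDerivAt (fun x => f (x + p y)) (fderiv ℝ f (x + p y)) x := by
        have := ((hf.differentiable one_ne_zero) (x + p y)).hasFDerivAt
        have h2 := this.comp x ((hasFDerivAt_id x).add_const (p y))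
        rw [ContinuousLinearMap.comp_id] at h2
        exact h2
      exact h1.const_mul (w y)
  constructor
  · rw [contDiff_one_iff_fderiv]
    refine ⟨fun x => (hder x).differentiableAt, ?_⟩
    have : fderiv ℝ (fun x => ∫ y in S, w y * f (x + p y) ∂μ) =
      fun x => ∫ y in S, w y • fderiv ℝ f (x + p y) ∂μ := funext fun x => (hder x).fderiv
    rw [this]
    exact continuous_parametric_integral_of_continuous hjoint hS
  · intro i x
    unfold pd
    rw [(hder x).fderiv, ContinuousLinearMap.integral_apply (hint x)]
    simp

def tavg {d : ℕ} (L : ℝ) (i : Fin d) (f : (Fin d → ℝ) → ℝ) (x : Fin d → ℝ) : ℝ :=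
  ∫ s in Set.Icc 0 L, (1 / L) * f (x + s • (Pi.single i 1 : Fin d → ℝ))

theorem tavg_eq {d : ℕ} {L : ℝ} (hL : 0 < L) (i : Fin d) (f : (Fin d → ℝ) → ℝ) (x : Fin d → ℝ) :
    L * tavg L i f x = ∫ s in (0:ℝ)..L, f (x + s • (Pi.single i 1 : Fin d → ℝ)) := by
  unfold tavg
  rw [integral_const_mul, integral_Icc_eq_integral_Ioc, ← intervalIntegral.integral_of_le hL.le]
  field_simp

theorem tavg_param {d : ℕ} {L : ℝ} (i : Fin d) {f : (Fin d → ℝ) → ℝ} (hf : ContDiff ℝ 1 f) :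
    ContDiff ℝ 1 (tavg L i f) ∧ ∀ j x, pd j (tavg L i f) x = tavg L i (pd j f) x :=
  tc_param (μ := volume) isCompact_Icc hf (w := fun _ => 1 / L) continuous_const
    (p := fun s : ℝ => s • (Pi.single i 1 : Fin d → ℝ)) (by fun_prop)

theorem tavg_cont {d : ℕ} {L : ℝ} (i : Fin d) {f : (Fin d → ℝ) → ℝ} (hf : Continuous f) :
    Continuous (tavg L i f) :=
  continuous_parametric_integral_of_continuous (by fun_prop) isCompact_Icc

theorem tavg_per {d : ℕ} {L : ℝ} (i : Fin d) {f : (Fin d → ℝ) → ℝ} (hf : Per L f) : Per L (tavg L i f) := by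
  intro x j
  unfold tavg
  congr 1; funext s
  rw [add_right_comm, hf]

theorem tavg_indep {d : ℕ} {L : ℝ} (i j : Fin d) {f : (Fin d → ℝ) → ℝ}
    (hf : ∀ x (r : ℝ), f (x + r • (Pi.single j 1 : Fin d → ℝ)) = f x) (x : Fin d → ℝ) (r : ℝ) :
    tavg L i f (x + r • (Pi.single j 1 : Fin d → ℝ)) = tavg L i f x := by
  unfold tavg
  congr 1; funext s
  rw [add_right_comm, hf]

theorem tavg_indep_self {d : ℕ} {L : ℝ} (hL : 0 < L) (i : Fin d) {f : (Fin d → ℝ) → ℝ}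
    (hf : Per L f) (x : Fin d → ℝ) (r : ℝ) :
    tavg L i f (x + r • (Pi.single i 1 : Fin d → ℝ)) = tavg L i f x := by
  apply mul_left_cancel₀ hL.ne'
  rw [tavg_eq hL, tavg_eq hL]
  have per : Function.Periodic (fun s : ℝ => f (x + s • (Pi.single i 1 : Fin d → ℝ))) L := by
    intro s
    simp only [add_smul]; rw [← add_assoc]; exact hf _ i
  have h1 := intervalIntegral.integral_comp_add_right (a := 0) (b := L)
    (fun s : ℝ => f (x + s • (Pi.single i 1 : Fin d → ℝ))) r
  have h2 := per.intervalIntegral_add_eq r 0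
  rw [zero_add, add_comm r L] at h2
  rw [zero_add, h2] at h1
  rw [← h1]
  congr 1; funext s
  rw [add_assoc, ← add_smul, add_comm r s]

theorem tavg_int {d : ℕ} {L : ℝ} (hL : 0 < L) (i : Fin d) {f : (Fin d → ℝ) → ℝ} (hf : Continuous f)
    (hp : Per L f) : ∫ x in box L d, tavg L i f x = ∫ x in box L d, f x := by
  unfold tavg
  rw [integral_integral_swap]
  · simp_rw [integral_const_mul]
    rw [setIntegral_congr_fun (g := fun _ => ∫ x in box L d, f x) measurableSet_Icc
      (fun s _ => by simp only; rw [tc_translate hL i hf hp])]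
    simp [hL.le]
    field_simp
  · rw [Measure.prod_restrict]
    refine ContinuousOn.integrableOn_compact ((tc_box_compact L d).prod isCompact_Icc) (Continuous.continuousOn ?_)
    unfold Function.uncurry
    fun_prop

theorem tavg_pos {d : ℕ} {L : ℝ} (hL : 0 < L) (i : Fin d) {f : (Fin d → ℝ) → ℝ} (hf : Continuous f)
    (hpos : ∀ x, 0 < f x) (x : Fin d → ℝ) : 0 < tavg L i f x := by
  have : 0 < ∫ s in (0:ℝ)..L, f (x + s • (Pi.single i 1 : Fin d → ℝ)) :=
    intervalIntegral.intervalIntegral_pos_of_pos_on (Continuous.intervalIntegrable (by fun_prop) _ _)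
      (fun x _ => hpos _) hL
  rw [← tavg_eq hL] at this
  exact pos_of_mul_pos_right this hL.le

theorem tavg_ent {d : ℕ} {L : ℝ} (hL : 0 < L) (i : Fin d) {ρ : (Fin d → ℝ) → ℝ} (hρ : ContDiff ℝ 1 ρ)
    (hp : Per L ρ) (hpos : ∀ x, 0 < ρ x) {c : ℝ} (hc : 0 < c) :
    ∫ x in box L d, ρ x * Real.log (ρ x * c) ≤
      (L / (2 * π)) ^ 2 * (∫ x in box L d, (pd i ρ x) ^ 2 / ρ x) +
      ∫ x in box L d, tavg L i ρ x * Real.log (tavg L i ρ x * c) := by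
  have hρc := hρ.continuous
  have hρd := tc_pd_cont i hρ
  have hAc := tavg_cont (L := L) i hρc
  have hApos := tavg_pos hL i hρc hpos
  have c1 : Continuous fun x => ρ x * Real.log (ρ x * c) :=
    hρc.mul ((hρc.mul continuous_const).log fun x => (mul_pos (hpos x) hc).ne')
  have c2 : Continuous fun x => (pd i ρ x) ^ 2 / ρ x := (hρd.pow 2).div hρc fun x => (hpos x).ne'
  have c3 : Continuous fun x => tavg L i ρ x * Real.log (tavg L i ρ x * c) :=
    hAc.mul ((hAc.mul continuous_const).log fun x => (mul_pos (hApos x) hc).ne')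
  have p1 : Per L fun x => ρ x * Real.log (ρ x * c) := fun x j => by simp only [hp x j]
  have p2 : Per L fun x => (pd i ρ x) ^ 2 / ρ x := fun x j => by simp only [hp x j, tc_per_pd i hp x j]
  rw [← tavg_int hL i c1 p1, ← tavg_int hL i c2 p2, ← integral_const_mul,
    ← integral_add ((tc_int L (tavg_cont i c2)).const_mul _) (tc_int L c3)]
  apply setIntegral_mono (tc_int L (tavg_cont i c1))
    ((tc_int L (tavg_cont i c2)).const_mul _ |>.add (tc_int L c3))
  intro x
  apply le_of_mul_le_mul_left _ hL
  have hl := ae_lsi1 hL (fun s => ρ (x + s • (Pi.single i 1 : Fin d → ℝ)))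
    (fun s => pd i ρ (x + s • (Pi.single i 1 : Fin d → ℝ)))
    (fun s => tc_line i (hρ.differentiable one_ne_zero) x s) (by fun_prop)
    (by simp [hp x i]) (fun s => hpos _) (tavg L i ρ x) (tavg_eq hL i ρ x)
  change L * _ ≤ L * (_ * _ + _)
  rw [mul_add]
  rw [tavg_eq hL, mul_left_comm, tavg_eq hL, ← mul_assoc, tavg_eq hL]
  set m := tavg L i ρ x with hm
  have hmp : 0 < m := hApos x
  have e : ∫ s in (0:ℝ)..L, ρ (x + s • (Pi.single i 1 : Fin d → ℝ)) * Real.log (ρ (x + s • (Pi.single i 1 : Fin d → ℝ)) * c)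
     = (∫ s in (0:ℝ)..L, ρ (x + s • (Pi.single i 1 : Fin d → ℝ)) * Real.log (ρ (x + s • (Pi.single i 1 : Fin d → ℝ)) / m))
      + (∫ s in (0:ℝ)..L, ρ (x + s • (Pi.single i 1 : Fin d → ℝ))) * Real.log (m * c) := by
    have cl : Continuous fun s : ℝ => x + s • (Pi.single i 1 : Fin d → ℝ) := by fun_prop
    have c4 : Continuous fun x => ρ x * Real.log (ρ x / m) :=
      hρc.mul ((hρc.div_const m).log fun x => (div_pos (hpos x) hmp).ne')
    rw [← intervalIntegral.integral_mul_const, ← intervalIntegral.integral_add]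
    · congr 1; funext s
      rw [← mul_add, ← Real.log_mul (div_pos (hpos _) hmp).ne' (mul_pos hmp hc).ne']
      congr 2; field_simp
    · exact (c4.comp cl).intervalIntegrable _ _
    · exact ((hρc.comp cl).mul continuous_const).intervalIntegrable _ _
  rw [e]
  linarith

theorem tavg_fisher {d : ℕ} {L : ℝ} (hL : 0 < L) (i j : Fin d) {ρ : (Fin d → ℝ) → ℝ} (hρ : ContDiff ℝ 1 ρ)
    (hp : Per L ρ) (hpos : ∀ x, 0 < ρ x) :
    ∫ x in box L d, (pd j (tavg L i ρ) x) ^ 2 / tavg L i ρ x ≤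
      ∫ x in box L d, (pd j ρ x) ^ 2 / ρ x := by
  have hρc := hρ.continuous
  have hρd := tc_pd_cont j hρ
  have hAc := tavg_cont (L := L) i hρc
  have hApos := tavg_pos hL i hρc hpos
  obtain ⟨hA1, hA2⟩ := tavg_param (L := L) i hρ
  have c2 : Continuous fun x => (pd j ρ x) ^ 2 / ρ x := (hρd.pow 2).div hρc fun x => (hpos x).ne'
  have p2 : Per L fun x => (pd j ρ x) ^ 2 / ρ x := fun x k => by simp only [hp x k, tc_per_pd j hp x k]
  have c3 : Continuous fun x => (pd j (tavg L i ρ) x) ^ 2 / tavg L i ρ x :=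
    ((tc_pd_cont j hA1).pow 2).div hAc fun x => (hApos x).ne'
  rw [← tavg_int hL i c2 p2]
  apply setIntegral_mono (tc_int L c3) (tc_int L (tavg_cont i c2))
  intro x
  simp only
  apply le_of_mul_le_mul_left _ hL
  rw [tavg_eq hL]
  set a := tavg L i ρ x with ha
  set b := pd j (tavg L i ρ) x with hb
  have hap : 0 < a := hApos x
  have h1 : L * a = ∫ s in (0:ℝ)..L, ρ (x + s • (Pi.single i 1 : Fin d → ℝ)) := tavg_eq hL i ρ x
  have h2 : L * b = ∫ s in (0:ℝ)..L, pd j ρ (x + s • (Pi.single i 1 : Fin d → ℝ)) := by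
    rw [hb, hA2]; exact tavg_eq hL i _ x
  have cl : Continuous fun s : ℝ => x + s • (Pi.single i 1 : Fin d → ℝ) := by fun_prop
  have h3 : ∫ s in (0:ℝ)..L, (2 * (b / a) * pd j ρ (x + s • (Pi.single i 1 : Fin d → ℝ))
      - (b / a) ^ 2 * ρ (x + s • (Pi.single i 1 : Fin d → ℝ))) ≤
      ∫ s in (0:ℝ)..L, (pd j ρ (x + s • (Pi.single i 1 : Fin d → ℝ))) ^ 2 /
        ρ (x + s • (Pi.single i 1 : Fin d → ℝ)) := by
    apply intervalIntegral.integral_mono_on hL.le (Continuous.intervalIntegrable (by fun_prop) _ _)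
      ((c2.comp cl).intervalIntegrable _ _)
    intro s _
    have := hpos (x + s • (Pi.single i 1 : Fin d → ℝ))
    change _ ≤ pd j ρ (x + s • (Pi.single i 1 : Fin d → ℝ)) ^ 2 / ρ (x + s • (Pi.single i 1 : Fin d → ℝ))
    rw [le_div_iff₀ this]
    nlinarith [sq_nonneg (pd j ρ (x + s • (Pi.single i 1 : Fin d → ℝ)) - b / a * ρ (x + s • (Pi.single i 1 : Fin d → ℝ)))]
  rw [intervalIntegral.integral_sub (Continuous.intervalIntegrable (by fun_prop) _ _)
    (Continuous.intervalIntegrable (by fun_prop) _ _), intervalIntegral.integral_const_mul,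
    intervalIntegral.integral_const_mul, ← h1, ← h2] at h3
  refine le_trans (le_of_eq ?_) h3
  field_simp; ring

theorem lsi_iter {d : ℕ} {L : ℝ} (hL : 0 < L) {c : ℝ} (hc : 0 < c) {ρ : (Fin d → ℝ) → ℝ} (hρ : ContDiff ℝ 1 ρ)
    (hp : Per L ρ) (hpos : ∀ x, 0 < ρ x) (S : Finset (Fin d)) :
    ∃ q : (Fin d → ℝ) → ℝ, ContDiff ℝ 1 q ∧ Per L q ∧ (∀ x, 0 < q x) ∧
      (∀ j ∈ S, ∀ x (r : ℝ), q (x + r • (Pi.single j 1 : Fin d → ℝ)) = q x) ∧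
      (∫ x in box L d, q x = ∫ x in box L d, ρ x) ∧
      (∀ j, ∫ x in box L d, (pd j q x) ^ 2 / q x ≤ ∫ x in box L d, (pd j ρ x) ^ 2 / ρ x) ∧
      ∫ x in box L d, ρ x * Real.log (ρ x * c) ≤
        (L / (2 * π)) ^ 2 * (∑ j ∈ S, ∫ x in box L d, (pd j ρ x) ^ 2 / ρ x) +
        ∫ x in box L d, q x * Real.log (q x * c) := by
  induction S using Finset.induction_on with
  | empty => exact ⟨ρ, hρ, hp, hpos, by simp, rfl, fun _ => le_rfl, by simp⟩
  | insert a S ha ih =>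
    obtain ⟨q, h1, h2, h3, h4, h5, h6, h7⟩ := ih
    refine ⟨tavg L a q, (tavg_param a h1).1, tavg_per a h2, tavg_pos hL a h1.continuous h3, ?_, ?_, ?_, ?_⟩
    · intro j hj x r
      rcases Finset.mem_insert.1 hj with h | h
      · subst h; exact tavg_indep_self hL j h2 x r
      · exact tavg_indep a j (h4 j h) x r
    · rw [tavg_int hL a h1.continuous h2, h5]
    · intro j
      exact (tavg_fisher hL a j h1 h2 h3).trans (h6 j)
    · rw [Finset.sum_insert ha, mul_add]
      have := tavg_ent hL a h1 h2 h3 hc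
      have h8 := mul_le_mul_of_nonneg_left (h6 a) (sq_nonneg (L / (2 * π)))
      linarith

theorem tc_vol {d : ℕ} {L : ℝ} (hL : 0 < L) : (volume : Measure (Fin d → ℝ)).real (box L d) = L ^ d := by
  unfold box Measure.real
  rw [Real.volume_Icc_pi]
  simp only [sub_neg_eq_add, add_halves, Finset.prod_const, Finset.card_univ, Fintype.card_fin]
  rw [ENNReal.toReal_pow, ENNReal.toReal_ofReal hL.le]

theorem lsi_main {d : ℕ} {L : ℝ} (hL : 0 < L) {ρ : (Fin d → ℝ) → ℝ} (hρ : ContDiff ℝ 1 ρ)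
    (hp : Per L ρ) (hpos : ∀ x, 0 < ρ x) (hint : ∫ x in box L d, ρ x = 1) :
    relEnt L ρ ≤ (L / (2 * π)) ^ 2 * ∑ j, ∫ x in box L d, (pd j ρ x) ^ 2 / ρ x := by
  obtain ⟨q, h1, h2, h3, h4, h5, h6, h7⟩ := lsi_iter hL (pow_pos hL d) hρ hp hpos Finset.univ
  have hconst : ∀ x, q x = q 0 := by
    intro x
    have : ∀ s : Finset (Fin d), q (∑ i ∈ s, x i • (Pi.single i 1 : Fin d → ℝ)) = q 0 := by
      intro s
      induction s using Finset.induction_on with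
      | empty => simp
      | insert a s ha ih =>
        rw [Finset.sum_insert ha, add_comm, h4 a (Finset.mem_univ a), ih]
    rw [← this Finset.univ]
    congr 1
    funext j; simp [Finset.sum_apply, Pi.single_apply]
  have hq : L ^ d * q 0 = 1 := by
    rw [← hint, ← h5]
    simp_rw [hconst]
    rw [setIntegral_const, tc_vol hL, smul_eq_mul]
  have hz : ∫ x in box L d, q x * Real.log (q x * L ^ d) = 0 := by
    simp_rw [hconst]
    rw [mul_comm (q 0) (L ^ d), hq]; simp
  unfold relEnt
  linarith

theorem g_rd {α : Type*} [MeasurableSpace α] {μ : Measure α} [IsFiniteMeasure μ] {q : ℝ → α → ℝ} {q' : α → ℝ}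
    {t δ C : ℝ} (hδ : 0 < δ) (hint : ∀ s ∈ Set.Ico t (t + δ), Integrable (q s) μ)
    (hL : ∀ s ∈ Set.Ico t (t + δ), ∀ x, |q s x - q t x| ≤ C * (s - t))
    (hd : ∀ x, HasDerivAt (fun s => q s x) (q' x) t) :
    HasDerivWithinAt (fun s => ∫ x, q s x ∂μ) (∫ x, q' x ∂μ) (Set.Ici t) t := by
  rw [← hasDerivWithinAt_Ioi_iff_Ici, hasDerivWithinAt_iff_tendsto_slope' (by simp)]
  have hev : ∀ᶠ s in nhdsWithin t (Set.Ioi t), s ∈ Set.Ioo t (t + δ) :=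
    Ioo_mem_nhdsGT (by linarith)
  have key : Filter.Tendsto (fun s => ∫ x, slope (fun s => q s x) t s ∂μ) (nhdsWithin t (Set.Ioi t))
      (nhds (∫ x, q' x ∂μ)) := by
    apply tendsto_integral_filter_of_dominated_convergence (fun _ => C)
    · filter_upwards [hev] with s hs
      have := ((hint s ⟨hs.1.le, hs.2⟩).sub (hint t ⟨le_rfl, by linarith⟩)).const_mul (s - t)⁻¹
      exact this.aestronglyMeasurable
    · filter_upwards [hev] with s hs
      refine Filter.Eventually.of_forall fun x => ?_
      have hp : 0 < s - t := by linarith [hs.1]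
      simp only [slope, vsub_eq_sub, smul_eq_mul, norm_mul, norm_inv, Real.norm_eq_abs, abs_of_pos hp]
      rw [inv_mul_le_iff₀ hp, mul_comm]
      exact hL s ⟨hs.1.le, hs.2⟩ x
    · exact integrable_const _
    · refine Filter.Eventually.of_forall fun x => ?_
      have := (hd x).hasDerivWithinAt (s := Set.Ioi t)
      rwa [hasDerivWithinAt_iff_tendsto_slope' (by simp)] at this
  refine key.congr' ?_
  filter_upwards [hev] with s hs
  simp only [slope, vsub_eq_sub, smul_eq_mul]
  rw [integral_const_mul, integral_sub (hint s ⟨hs.1.le, hs.2⟩) (hint t ⟨le_rfl, by linarith⟩)]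

theorem g_fatou {α : Type*} [MeasurableSpace α] {μ : Measure α} [IsFiniteMeasure μ]
    {Gn ρn : ℕ → α → ℝ} {G ρ : α → ℝ} {A B m c : ℝ} {cn : ℕ → ℝ}
    (hG : ∀ n, Integrable (Gn n) μ) (hρ : ∀ n, Integrable (ρn n) μ) (hρ0 : Integrable ρ μ)
    (hm : ∀ n, ∫ x, ρn n x ∂μ = m) (hm0 : ∫ x, ρ x ∂μ = m)
    (hlb : ∀ n x, -A - B * ρn n x ≤ Gn n x)
    (hlim : ∀ x, Filter.Tendsto (fun n => Gn n x) Filter.atTop (nhds (G x)))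
    (hlimρ : ∀ x, Filter.Tendsto (fun n => ρn n x) Filter.atTop (nhds (ρ x)))
    (hcn : ∀ n, ∫ x, Gn n x ∂μ ≤ cn n) (hc : Filter.Tendsto cn Filter.atTop (nhds c)) :
    Integrable G μ ∧ ∫ x, G x ∂μ ≤ c := by
  let fn : ℕ → α → ℝ := fun n x => Gn n x + (A + B * ρn n x)
  let f : α → ℝ := fun x => G x + (A + B * ρ x)
  let K : ℝ := μ.real Set.univ * A + B * m
  have hfn0 : ∀ n x, 0 ≤ fn n x := fun n x => by have := hlb n x; simp only [fn]; linarith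
  have hlimf : ∀ x, Filter.Tendsto (fun n => fn n x) Filter.atTop (nhds (f x)) := fun x =>
    (hlim x).add (((hlimρ x).const_mul B).const_add A)
  have hf0 : ∀ x, 0 ≤ f x := fun x => ge_of_tendsto' (hlimf x) fun n => hfn0 n x
  have hfni : ∀ n, Integrable (fn n) μ := fun n =>
    (hG n).add ((integrable_const A).add ((hρ n).const_mul B))
  have hre : Integrable (fun x => A + B * ρ x) μ := (integrable_const A).add (hρ0.const_mul B)
  have hfnint : ∀ n, ∫ x, fn n x ∂μ = ∫ x, Gn n x ∂μ + K := by
    intro n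
    simp only [fn]
    have hri : Integrable (fun x => A + B * ρn n x) μ := (integrable_const A).add ((hρ n).const_mul B)
    rw [integral_add (hG n) hri,
      integral_add (integrable_const A) ((hρ n).const_mul B), integral_const_mul, hm n]
    simp [K]
  have hKint : ∫ x, (A + B * ρ x) ∂μ = K := by
    rw [integral_add (integrable_const A) (hρ0.const_mul B), integral_const_mul, hm0]
    simp [K]
  have hfm : AEStronglyMeasurable f μ :=
    aestronglyMeasurable_of_tendsto_ae Filter.atTop (fun n => (hfni n).aestronglyMeasurable)
      (Filter.Eventually.of_forall hlimf)
  have hcK : Filter.Tendsto (fun n => cn n + K) Filter.atTop (nhds (c + K)) := hc.add_const K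
  have hcK0 : 0 ≤ c + K := ge_of_tendsto' hcK fun n => by
    have h1 : 0 ≤ ∫ x, fn n x ∂μ := integral_nonneg (hfn0 n)
    rw [hfnint n] at h1
    linarith [hcn n]
  have hl : ∫⁻ x, ENNReal.ofReal (f x) ∂μ ≤ ENNReal.ofReal (c + K) := by
    have e : ∀ x, ENNReal.ofReal (f x) = Filter.liminf (fun n => ENNReal.ofReal (fn n x)) Filter.atTop := fun x =>
      ((ENNReal.continuous_ofReal.tendsto _).comp (hlimf x)).liminf_eq.symm
    calc ∫⁻ x, ENNReal.ofReal (f x) ∂μ = ∫⁻ x, Filter.liminf (fun n => ENNReal.ofReal (fn n x)) Filter.atTop ∂μ := by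
          simp_rw [e]
      _ ≤ Filter.liminf (fun n => ∫⁻ x, ENNReal.ofReal (fn n x) ∂μ) Filter.atTop :=
          lintegral_liminf_le' fun n => (hfni n).aestronglyMeasurable.aemeasurable.ennreal_ofReal
      _ ≤ Filter.liminf (fun n => ENNReal.ofReal (cn n + K)) Filter.atTop := by
          refine Filter.liminf_le_liminf (Filter.Eventually.of_forall fun n => ?_)
          rw [← ofReal_integral_eq_lintegral_ofReal (hfni n) (Filter.Eventually.of_forall (hfn0 n))]
          apply ENNReal.ofReal_le_ofReal
          rw [hfnint n]; linarith [hcn n]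
      _ = ENNReal.ofReal (c + K) := ((ENNReal.continuous_ofReal.tendsto _).comp hcK).liminf_eq
  have hfi : Integrable f μ := by
    refine ⟨hfm, ?_⟩
    rw [hasFiniteIntegral_iff_ofReal (Filter.Eventually.of_forall hf0)]
    exact hl.trans_lt ENNReal.ofReal_lt_top
  have hGi : Integrable G μ := by
    have := hfi.sub hre
    refine this.congr (Filter.Eventually.of_forall fun x => ?_)
    simp [f]
  refine ⟨hGi, ?_⟩
  have h1 : ∫ x, f x ∂μ ≤ c + K := by
    rw [integral_eq_lintegral_of_nonneg_ae (Filter.Eventually.of_forall hf0) hfm]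
    exact ENNReal.toReal_le_of_le_ofReal hcK0 hl
  have h2 : ∫ x, f x ∂μ = ∫ x, G x ∂μ + K := by
    rw [← hKint, ← integral_add hGi hre]
  linarith

/-- sequential left lower semicontinuity on an interval -/
def LLsc (f : ℝ → ℝ) (a b : ℝ) : Prop :=
  ∀ t ∈ Set.Ioc a b, ∀ s : ℕ → ℝ, (∀ n, s n ∈ Set.Ico a t) → Filter.Tendsto s Filter.atTop (nhds t) →
    ∀ (c : ℕ → ℝ) (C : ℝ), Filter.Tendsto c Filter.atTop (nhds C) → (∀ n, f (s n) ≤ c n) → f t ≤ C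

theorem g_mv0 {f : ℝ → ℝ} {a b ε : ℝ} (hε : 0 < ε)
    (hd : ∀ t ∈ Set.Ico a b, ∃ f' ≤ 0, HasDerivWithinAt f f' (Set.Ici t) t) (hl : LLsc f a b) :
    ∀ t ∈ Set.Icc a b, f t ≤ f a + ε * (t - a) := by
  by_contra hcon
  push Not at hcon
  obtain ⟨t0, ht0, hft0⟩ := hcon
  let V : Set ℝ := {t | t ∈ Set.Icc a b ∧ f a + ε * (t - a) < f t}
  have hVne : V.Nonempty := ⟨t0, ht0, hft0⟩
  have hVbdd : BddBelow V := ⟨a, fun t ht => ht.1.1⟩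
  set T := sInf V with hT
  have haT : a ≤ T := le_csInf hVne fun t ht => ht.1.1
  have hTt0 : T ≤ t0 := csInf_le hVbdd ⟨ht0, hft0⟩
  have hTb : T ≤ b := hTt0.trans ht0.2
  have hbef : ∀ s ∈ Set.Ico a T, f s ≤ f a + ε * (s - a) := by
    intro s hs
    by_contra h
    push Not at h
    have : T ≤ s := csInf_le hVbdd ⟨⟨hs.1, hs.2.le.trans hTb⟩, h⟩
    linarith [hs.2]
  have hfT : f T ≤ f a + ε * (T - a) := by
    rcases haT.eq_or_lt with h | h
    · rw [← h]; simp
    · obtain ⟨s, -, hs1, hs2⟩ := exists_seq_strictMono_tendsto' h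
      have hs : Filter.Tendsto (fun n => f a + ε * (s n - a)) Filter.atTop (nhds (f a + ε * (T - a))) :=
        ((hs2.sub_const a).const_mul ε).const_add _
      exact hl T ⟨h, hTb⟩ s (fun n => ⟨(hs1 n).1.le, (hs1 n).2⟩) hs2 _ _ hs
        (fun n => hbef _ ⟨(hs1 n).1.le, (hs1 n).2⟩)
  have hTb' : T < b := by
    rcases hTb.eq_or_lt with h | h
    · have : t0 = T := le_antisymm (h ▸ ht0.2) hTt0
      rw [this] at hft0; linarith
    · exact h
  obtain ⟨f', hf', hder⟩ := hd T ⟨haT, hTb'⟩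
  rw [← hasDerivWithinAt_Ioi_iff_Ici, hasDerivWithinAt_iff_tendsto_slope' (by simp)] at hder
  have hev := hder.eventually (gt_mem_nhds (lt_of_le_of_lt hf' hε))
  obtain ⟨u, hu, hu2⟩ := mem_nhdsGT_iff_exists_Ioo_subset.1 hev
  have hTu : T < u := hu
  have : u ≤ T := by
    apply le_csInf hVne
    intro t ht
    by_contra hlt
    push Not at hlt
    have hTt : T ≤ t := csInf_le hVbdd ht
    rcases hTt.eq_or_lt with h | h
    · have := ht.2; rw [← h] at this; linarith
    · have h1 : slope f T t < ε := hu2 ⟨h, hlt⟩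
      rw [slope_def_field, div_lt_iff₀ (by linarith)] at h1
      have := ht.2
      nlinarith
  linarith

theorem g_mv {f : ℝ → ℝ} {a b : ℝ} (hab : a ≤ b)
    (hd : ∀ t ∈ Set.Ico a b, ∃ f' ≤ 0, HasDerivWithinAt f f' (Set.Ici t) t) (hl : LLsc f a b) :
    f b ≤ f a := by
  apply le_of_forall_pos_le_add
  intro ε hε
  have := g_mv0 (ε := ε / (b - a + 1)) (by have : 0 < b - a + 1 := by linarith
                                           positivity) hd hl b ⟨hab, le_rfl⟩
  have h2 : ε / (b - a + 1) * (b - a) ≤ ε := by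
    rw [div_mul_eq_mul_div, div_le_iff₀ (by linarith)]
    nlinarith
  linarith

theorem g_gron {F : ℝ → ℝ} {a b k : ℝ} (hab : a ≤ b)
    (hd : ∀ t ∈ Set.Ico a b, ∃ f' ≤ k * F t, HasDerivWithinAt F f' (Set.Ici t) t) (hl : LLsc F a b) :
    F b ≤ Real.exp (k * (b - a)) * F a := by
  have hE : ∀ t : ℝ, HasDerivAt (fun t => Real.exp (-k * t)) (Real.exp (-k * t) * (-k)) t := fun t => by
    simpa using ((hasDerivAt_id t).const_mul (-k)).exp
  have := g_mv (f := fun t => Real.exp (-k * t) * F t) hab ?_ ?_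
  · have h2 := mul_le_mul_of_nonneg_left this (Real.exp_pos (k * b)).le
    rw [← mul_assoc, ← mul_assoc, ← Real.exp_add, ← Real.exp_add] at h2
    rw [show k * b + -k * b = 0 by ring, Real.exp_zero, one_mul,
      show k * b + -k * a = k * (b - a) by ring] at h2
    exact h2
  · intro t ht
    obtain ⟨f', h1, h2⟩ := hd t ht
    refine ⟨_, ?_, (hE t).hasDerivWithinAt.mul h2⟩
    have := Real.exp_pos (-k * t)
    nlinarith
  · intro t ht s hs hst c C hc hle
    have hx : Filter.Tendsto (fun n => Real.exp (k * s n) * c n) Filter.atTop (nhds (Real.exp (k * t) * C)) :=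
      (((hst.const_mul k).rexp).mul hc)
    have h3 := hl t ht s hs hst _ _ hx (fun n => by
      have h2 := mul_le_mul_of_nonneg_left (hle n) (Real.exp_pos (k * s n)).le
      rw [← mul_assoc, ← Real.exp_add, show k * s n + -k * s n = 0 by ring, Real.exp_zero, one_mul] at h2
      exact h2)
    have h2 := mul_le_mul_of_nonneg_left h3 (Real.exp_pos (-k * t)).le
    rw [← mul_assoc, ← Real.exp_add, show -k * t + k * t = 0 by ring, Real.exp_zero, one_mul] at h2
    exact h2

theorem g_lin {F : ℝ → ℝ} {a b m : ℝ} (hab : a ≤ b)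
    (hd : ∀ t ∈ Set.Ico a b, ∃ f' ≤ m, HasDerivWithinAt F f' (Set.Ici t) t) (hl : LLsc F a b) :
    F b ≤ F a + m * (b - a) := by
  have := g_mv (f := fun t => F t - m * t) hab ?_ ?_
  · linarith
  · intro t ht
    obtain ⟨f', h1, h2⟩ := hd t ht
    refine ⟨f' - m, by linarith, h2.sub ?_⟩
    simpa using ((hasDerivAt_id t).const_mul m).hasDerivWithinAt
  · intro t ht s hs hst c C hc hle
    have hx : Filter.Tendsto (fun n => c n + m * s n) Filter.atTop (nhds (C + m * t)) :=
      hc.add (hst.const_mul m)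
    have h3 := hl t ht s hs hst _ _ hx (fun n => by have := hle n; linarith)
    simp only; linarith

theorem ib_zero {d : ℕ} {L : ℝ} (hL : 0 < L) {f : (Fin d → ℝ) → ℝ} (hf : Continuous f) (hp : Per L f)
    (h0 : ∀ x, 0 ≤ f x) (hi : ∫ x in box L d, f x ≤ 0) : ∀ x, f x = 0 := by
  have hz : ∫ x in box L d, f x = 0 := le_antisymm hi (integral_nonneg h0)
  have hae : f =ᵐ[volume.restrict (box L d)] 0 :=
    (integral_eq_zero_iff_of_nonneg h0 (tc_int L hf)).1 hz
  have hsub : box L d ⊆ closure (interior (box L d)) := by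
    have e : box L d = Set.pi Set.univ (fun _ => Set.Icc (-(L / 2)) (L / 2)) := by
      unfold box; rw [← Set.pi_univ_Icc]
    rw [e, interior_pi_set Set.finite_univ, closure_pi_set]
    simp only [closure_interior_Icc (show -(L / 2) ≠ L / 2 by linarith)]
    exact subset_rfl
  have := Measure.eqOn_of_ae_eq hae hf.continuousOn continuousOn_const hsub
  intro x
  obtain ⟨y, hy, hxy⟩ := tc_reduce hL x
  rw [hxy f hp]
  exact this hy

theorem ib_1 {d : ℕ} {L : ℝ} (hL : 0 < L) (i : Fin d) {u : (Fin d → ℝ) → ℝ} (hu : ContDiff ℝ 2 u) (hp : Per L u)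
    {g g' : ℝ → ℝ} (hg : ∀ x, ContDiffAt ℝ 1 g (u x)) (hg' : ∀ x, HasDerivAt g (g' (u x)) (u x)) :
    Continuous (fun x => g' (u x) * (pd i u x) ^ 2) ∧
    ∫ x in box L d, g (u x) * pd i (pd i u) x = - ∫ x in box L d, g' (u x) * (pd i u x) ^ 2 := by
  have hu1 : ContDiff ℝ 1 u := hu.of_le one_le_two
  have hd1 := tc_pd_c1 i hu
  have hgu : ContDiff ℝ 1 (fun x => g (u x)) :=
    contDiff_iff_contDiffAt.2 fun x => (hg x).comp x hu1.contDiffAt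
  have hprod : ContDiff ℝ 1 (fun x => g (u x) * pd i u x) := hgu.mul hd1
  have hpp : Per L (fun x => g (u x) * pd i u x) := fun x j => by simp only [hp x j, tc_per_pd i hp x j]
  have e : ∀ x, pd i (fun x => g (u x) * pd i u x) x =
      g (u x) * pd i (pd i u) x + g' (u x) * (pd i u x) ^ 2 := by
    intro x
    rw [tc_pd_mul i (hgu.differentiable one_ne_zero x) (hd1.differentiable one_ne_zero x),
      tc_pd_comp (h' := g') i (hu1.differentiable one_ne_zero x) (hg' x)]
    ring
  have c1 : Continuous fun x => g (u x) * pd i (pd i u) x := hgu.continuous.mul (tc_pd_cont i hd1)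
  have c2 : Continuous (fun x => g' (u x) * (pd i u x) ^ 2) := by
    have := (tc_pd_cont i hprod).sub c1
    refine this.congr fun x => ?_
    change pd i (fun x => g (u x) * pd i u x) x - _ = _
    rw [e]; ring
  refine ⟨c2, ?_⟩
  have := tc_int_pd hL i hprod hpp
  simp_rw [e] at this
  rw [integral_add (tc_int L c1) (tc_int L c2)] at this
  linarith

theorem ib_2 {d : ℕ} {L : ℝ} (hL : 0 < L) (i : Fin d) {u b : (Fin d → ℝ) → ℝ} (hu : ContDiff ℝ 1 u) (hp : Per L u)
    (hb : ContDiff ℝ 1 b) (hbp : Per L b)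
    {h g : ℝ → ℝ} (hh : ∀ x, ContDiffAt ℝ 1 h (u x)) (hg : ∀ x, HasDerivAt h (g (u x)) (u x))
    (hgc : Continuous fun x => g (u x)) :
    ∫ x in box L d, g (u x) * (u x * pd i b x + b x * pd i u x) =
      ∫ x in box L d, (u x * g (u x) - h (u x)) * pd i b x := by
  have hhu : ContDiff ℝ 1 (fun x => h (u x)) :=
    contDiff_iff_contDiffAt.2 fun x => (hh x).comp x hu.contDiffAt
  have hprod : ContDiff ℝ 1 (fun x => h (u x) * b x) := hhu.mul hb
  have hpp : Per L (fun x => h (u x) * b x) := fun x j => by simp only [hp x j, hbp x j]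
  have e : ∀ x, pd i (fun x => h (u x) * b x) x =
      g (u x) * (u x * pd i b x + b x * pd i u x) - (u x * g (u x) - h (u x)) * pd i b x := by
    intro x
    rw [tc_pd_mul i (hhu.differentiable one_ne_zero x) (hb.differentiable one_ne_zero x),
      tc_pd_comp (h' := g) i (hu.differentiable one_ne_zero x) (hg x)]
    ring
  have h1 := tc_pd_cont i hu
  have h2 := tc_pd_cont i hb
  have h3 := hu.continuous
  have h4 := hb.continuous
  have h5 := hhu.continuous
  have := tc_int_pd hL i hprod hpp
  simp_rw [e] at this
  have k1 : Continuous fun x => g (u x) * (u x * pd i b x + b x * pd i u x) :=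
    hgc.mul ((h3.mul h2).add (h4.mul h1))
  have k2 : Continuous fun x => (u x * g (u x) - h (u x)) * pd i b x := ((h3.mul hgc).sub h5).mul h2
  rw [integral_sub (tc_int L k1) (tc_int L k2)] at this
  linarith

theorem ib_diss {d : ℕ} {L κ : ℝ} (hL : 0 < L) {u : (Fin d → ℝ) → ℝ} {b : Fin d → (Fin d → ℝ) → ℝ}
    (hu : ContDiff ℝ 2 u) (hp : Per L u)
    (hb : ∀ i, ContDiff ℝ 1 (b i)) (hbp : ∀ i, Per L (b i))
    {h g g' : ℝ → ℝ} (hh : ∀ x, ContDiffAt ℝ 1 h (u x)) (hg : ∀ x, HasDerivAt h (g (u x)) (u x))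
    (hgd : ∀ x, ContDiffAt ℝ 1 g (u x)) (hg' : ∀ x, HasDerivAt g (g' (u x)) (u x)) :
    ∫ x in box L d, g (u x) * (κ * (∑ i, (u x * pd i (b i) x + b i x * pd i u x)) + ∑ i, pd i (pd i u) x) =
      - (∑ i, ∫ x in box L d, g' (u x) * (pd i u x) ^ 2) +
      κ * ∫ x in box L d, (u x * g (u x) - h (u x)) * ∑ i, pd i (b i) x := by
  have hu1 : ContDiff ℝ 1 u := hu.of_le one_le_two
  have hgu : ContDiff ℝ 1 (fun x => g (u x)) :=
    contDiff_iff_contDiffAt.2 fun x => (hgd x).comp x hu1.contDiffAt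
  have hhu : ContDiff ℝ 1 (fun x => h (u x)) :=
    contDiff_iff_contDiffAt.2 fun x => (hh x).comp x hu1.contDiffAt
  have hgc := hgu.continuous
  have hhc := hhu.continuous
  have huc := hu1.continuous
  have h1 := fun i => tc_pd_cont i hu1
  have h2 := fun i => tc_pd_cont i (hb i)
  have h3 := fun i => tc_pd_cont i (tc_pd_c1 i hu)
  have h4 := fun i => (hb i).continuous
  have e : ∀ x, g (u x) * (κ * (∑ i, (u x * pd i (b i) x + b i x * pd i u x)) + ∑ i, pd i (pd i u) x) =
      ∑ i, (κ * (g (u x) * (u x * pd i (b i) x + b i x * pd i u x)) + g (u x) * pd i (pd i u) x) := by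
    intro x
    rw [mul_add, Finset.mul_sum, Finset.mul_sum, Finset.mul_sum, Finset.sum_add_distrib]
    congr 1
    exact Finset.sum_congr rfl fun i _ => by ring
  have e2 : ∀ x, (u x * g (u x) - h (u x)) * ∑ i, pd i (b i) x =
      ∑ i, (u x * g (u x) - h (u x)) * pd i (b i) x := fun x => Finset.mul_sum _ _ _
  simp_rw [e, e2]
  have k1 : ∀ i, Continuous fun x => κ * (g (u x) * (u x * pd i (b i) x + b i x * pd i u x)) := fun i =>
    continuous_const.mul (hgc.mul ((huc.mul (h2 i)).add ((h4 i).mul (h1 i))))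
  have k2 : ∀ i, Continuous fun x => g (u x) * pd i (pd i u) x := fun i => hgc.mul (h3 i)
  have k3 : ∀ i, Continuous fun x => κ * (g (u x) * (u x * pd i (b i) x + b i x * pd i u x)) +
      g (u x) * pd i (pd i u) x := fun i => (k1 i).add (k2 i)
  have k4 : ∀ i, Continuous fun x => (u x * g (u x) - h (u x)) * pd i (b i) x := fun i =>
    ((huc.mul hgc).sub hhc).mul (h2 i)
  rw [integral_finsetSum _ (fun i _ => tc_int L (k3 i)),
    integral_finsetSum _ (fun i _ => tc_int L (k4 i)), Finset.mul_sum, ← Finset.sum_neg_distrib,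
    ← Finset.sum_add_distrib]
  refine Finset.sum_congr rfl fun i _ => ?_
  rw [integral_add (tc_int L (k1 i)) (tc_int L (k2 i)), integral_const_mul,
    ib_2 hL i hu1 hp (hb i) (hbp i) hh hg hgc, (ib_1 hL i hu hp hgd hg').2]
  ring

structure Sol (d : ℕ) (L κ M β : ℝ) (ρ : ℝ → (Fin d → ℝ) → ℝ) (B : ℝ → Fin d → (Fin d → ℝ) → ℝ) : Prop where
  hL : 0 < L
  hκ : 0 < κ
  hM : 0 ≤ M
  hβ : 0 ≤ β
  reg : ∀ t > (0:ℝ), ContDiff ℝ 2 (ρ t)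
  per : ∀ t > (0:ℝ), Per L (ρ t)
  cont : ∀ x, ContinuousOn (fun t => ρ t x) (Set.Ici (0:ℝ))
  pos : ∀ t > (0:ℝ), ∀ x, 0 < ρ t x
  prob : ∀ t > (0:ℝ), ∫ x in box L d, ρ t x = 1
  B1 : ∀ t > (0:ℝ), ∀ i, ContDiff ℝ 1 (B t i)
  Bper : ∀ t > (0:ℝ), ∀ i, Per L (B t i)
  Bbd : ∀ t > (0:ℝ), ∀ i x, |B t i x| ≤ β
  Bdiv : ∀ t > (0:ℝ), ∀ x, |∑ i, pd i (B t i) x| ≤ M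
  pde : ∀ t > (0:ℝ), ∀ x, HasDerivAt (fun s => ρ s x)
    (κ * (∑ i, (ρ t x * pd i (B t i) x + B t i x * pd i (ρ t) x)) + ∑ i, pd i (pd i (ρ t)) x) t

def RL {d : ℕ} (ρ : ℝ → (Fin d → ℝ) → ℝ) (t : ℝ) : Prop :=
  ∃ C δ : ℝ, 0 < δ ∧ ∀ s ∈ Set.Ico t (t + δ), ∀ x, |ρ s x - ρ t x| ≤ C * (s - t)

def he (ε u : ℝ) : ℝ := (√(u ^ 2 + ε ^ 2) + u) / 2
def he1 (ε u : ℝ) : ℝ := (u / √(u ^ 2 + ε ^ 2) + 1) / 2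
def he2 (ε u : ℝ) : ℝ := ε ^ 2 / (2 * √(u ^ 2 + ε ^ 2) ^ 3)

theorem he_pos {ε : ℝ} (hε : 0 < ε) (u : ℝ) : 0 < u ^ 2 + ε ^ 2 := by positivity

theorem he_cd {ε : ℝ} (hε : 0 < ε) : ContDiff ℝ 1 (he ε) := by
  unfold he
  have : ContDiff ℝ 1 fun u : ℝ => √(u ^ 2 + ε ^ 2) :=
    ContDiff.sqrt (by fun_prop) fun u => (he_pos hε u).ne'
  fun_prop

theorem he1_cd {ε : ℝ} (hε : 0 < ε) : ContDiff ℝ 1 (he1 ε) := by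
  unfold he1
  have : ContDiff ℝ 1 fun u : ℝ => √(u ^ 2 + ε ^ 2) :=
    ContDiff.sqrt (by fun_prop) fun u => (he_pos hε u).ne'
  have h2 : ContDiff ℝ 1 fun u : ℝ => u / √(u ^ 2 + ε ^ 2) :=
    contDiff_id.div this fun u => (Real.sqrt_pos.2 (he_pos hε u)).ne'
  fun_prop

theorem he_sd {ε : ℝ} (hε : 0 < ε) (u : ℝ) :
    HasDerivAt (fun u => √(u ^ 2 + ε ^ 2)) (u / √(u ^ 2 + ε ^ 2)) u := by
  have h1 : HasDerivAt (fun u : ℝ => u ^ 2 + ε ^ 2) (2 * u) u := by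
    simpa using ((hasDerivAt_pow 2 u).add_const (ε ^ 2))
  have := h1.sqrt (he_pos hε u).ne'
  convert this using 1
  have := (Real.sqrt_pos.2 (he_pos hε u)).ne'
  field_simp

theorem he_d {ε : ℝ} (hε : 0 < ε) (u : ℝ) : HasDerivAt (he ε) (he1 ε u) u :=
  ((he_sd hε u).add (hasDerivAt_id u)).div_const 2

theorem he1_d {ε : ℝ} (hε : 0 < ε) (u : ℝ) : HasDerivAt (he1 ε) (he2 ε u) u := by
  have h0 := Real.sqrt_pos.2 (he_pos hε u)
  have := (((hasDerivAt_id u).div (he_sd hε u) h0.ne').add_const 1).div_const 2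
  refine this.congr_deriv ?_
  unfold he2
  have hs := Real.sq_sqrt (he_pos hε u).le
  simp only [id]
  set s := √(u ^ 2 + ε ^ 2)
  have : ε ^ 2 = s ^ 2 - u ^ 2 := by linarith
  rw [this]
  field_simp

theorem he_abs {ε : ℝ} (_hε : 0 < ε) (u : ℝ) : |u| ≤ √(u ^ 2 + ε ^ 2) := Real.abs_le_sqrt (by nlinarith)

theorem he_up {ε : ℝ} (hε : 0 < ε) (u : ℝ) : √(u ^ 2 + ε ^ 2) ≤ |u| + ε := by
  rw [Real.sqrt_le_left (by positivity)]
  have := abs_nonneg u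
  nlinarith [sq_abs u]

theorem he_lip {ε : ℝ} (hε : 0 < ε) (u v : ℝ) : |he ε u - he ε v| ≤ |u - v| := by
  have h1 := Real.sqrt_pos.2 (he_pos hε u)
  have h2 := Real.sqrt_pos.2 (he_pos hε v)
  have h3 := Real.sq_sqrt (he_pos hε u).le
  have h4 := Real.sq_sqrt (he_pos hε v).le
  have h5 := he_abs hε u
  have h6 := he_abs hε v
  have key : |√(u ^ 2 + ε ^ 2) - √(v ^ 2 + ε ^ 2)| ≤ |u - v| := by
    set s := √(u ^ 2 + ε ^ 2)
    set r := √(v ^ 2 + ε ^ 2)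
    have e : (s - r) * (s + r) = (u - v) * (u + v) := by linarith
    have e2 : |s - r| * (s + r) = |u - v| * |u + v| := by
      rw [← abs_of_pos (show 0 < s + r by linarith), ← abs_mul, e, abs_mul]
    have h7 : |u + v| ≤ s + r := (abs_add_le u v).trans (by linarith)
    have h8 := mul_le_mul_of_nonneg_left h7 (abs_nonneg (u - v))
    rw [← e2] at h8
    exact le_of_mul_le_mul_right h8 (by linarith)
  unfold he
  rw [show (√(u ^ 2 + ε ^ 2) + u) / 2 - (√(v ^ 2 + ε ^ 2) + v) / 2 =
    ((√(u ^ 2 + ε ^ 2) - √(v ^ 2 + ε ^ 2)) + (u - v)) / 2 by ring, abs_div, abs_two]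
  have := abs_add_le (√(u ^ 2 + ε ^ 2) - √(v ^ 2 + ε ^ 2)) (u - v)
  linarith

theorem he_ge {ε : ℝ} (hε : 0 < ε) (u : ℝ) : max u 0 ≤ he ε u := by
  have h5 := he_abs hε u
  unfold he
  apply max_le
  · linarith [le_abs_self u]
  · linarith [neg_abs_le u]

theorem he_le {ε : ℝ} (hε : 0 < ε) (u : ℝ) : he ε u ≤ |u| + ε := by
  have h5 := he_up hε u
  unfold he
  linarith [le_abs_self u, abs_nonneg u]

theorem he1_nn {ε : ℝ} (hε : 0 < ε) (u : ℝ) : 0 ≤ he1 ε u := by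
  have h1 := Real.sqrt_pos.2 (he_pos hε u)
  have h5 := he_abs hε u
  unfold he1
  have : -1 ≤ u / √(u ^ 2 + ε ^ 2) := by
    rw [le_div_iff₀ h1]; linarith [neg_abs_le u]
  linarith

theorem he2_nn {ε : ℝ} (u : ℝ) : 0 ≤ he2 ε u := by unfold he2; positivity

theorem he_k {ε : ℝ} (hε : 0 < ε) (u : ℝ) : |u * he1 ε u - he ε u| ≤ ε := by
  have h1 := Real.sqrt_pos.2 (he_pos hε u)
  have h3 := Real.sq_sqrt (he_pos hε u).le
  have h6 : ε ≤ √(u ^ 2 + ε ^ 2) := Real.le_sqrt_of_sq_le (by nlinarith)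
  unfold he he1
  set s := √(u ^ 2 + ε ^ 2)
  have : u * ((u / s + 1) / 2) - (s + u) / 2 = - (ε ^ 2 / (2 * s)) := by
    field_simp; linarith
  rw [this, abs_neg, abs_of_pos (by positivity), div_le_iff₀ (by positivity)]
  nlinarith

theorem pd_aff {d : ℕ} (i : Fin d) {f g : (Fin d → ℝ) → ℝ} {x : Fin d → ℝ} (hf : DifferentiableAt ℝ f x)
    (hg : DifferentiableAt ℝ g x) (σ c : ℝ) :
    pd i (fun y => σ * (f y - g y) - c) x = σ * (pd i f x - pd i g x) := by
  have h := (((hf.hasFDerivAt.sub hg.hasFDerivAt).const_mul σ).sub_const c).fderiv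
  unfold pd
  have e : (fun y => σ * (f y - g y) - c) = fun y => σ * (f - g) y - c := rfl
  rw [e, h]; simp

theorem pd_aff0 {d : ℕ} (i : Fin d) {f g : (Fin d → ℝ) → ℝ} {x : Fin d → ℝ} (hf : DifferentiableAt ℝ f x)
    (hg : DifferentiableAt ℝ g x) (σ : ℝ) :
    pd i (fun y => σ * (f y - g y)) x = σ * (pd i f x - pd i g x) := by
  have := pd_aff i hf hg σ 0
  simpa using this

theorem box_fin (L : ℝ) (d : ℕ) : IsFiniteMeasure ((volume : Measure (Fin d → ℝ)).restrict (box L d)) :=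
  ⟨by rw [Measure.restrict_apply_univ]; exact (tc_box_compact L d).measure_lt_top⟩

section
variable {d : ℕ} {L κ M β : ℝ} {ρ : ℝ → (Fin d → ℝ) → ℝ} {B : ℝ → Fin d → (Fin d → ℝ) → ℝ}

theorem gap_pt (S : Sol d L κ M β ρ B) {a t N σ K : ℝ} (ha : 0 < a) (hat : a ≤ t)
    (h1 : ∀ x, ρ a x ≤ N) (h2 : ∀ i x, |pd i (ρ a) x| ≤ N) (h3 : ∀ i x, |pd i (pd i (ρ a)) x| ≤ N)
    (hsm : κ * M * (t - a) ≤ 1 / 2) (hσ : |σ| = 1)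
    (hK : K = 2 * (d * N + κ * (d * (β * N) + M * N))) (x : Fin d → ℝ) :
    σ * (κ * (∑ i, (ρ t x * pd i (B t i) x + B t i x * pd i (ρ t) x)) + ∑ i, pd i (pd i (ρ t)) x) - K ≤
    κ * (∑ i, ((σ * (ρ t x - ρ a x) - K * (t - a)) * pd i (B t i) x +
      B t i x * (σ * (pd i (ρ t) x - pd i (ρ a) x)))) +
      ∑ i, σ * (pd i (pd i (ρ t)) x - pd i (pd i (ρ a)) x) := by
  have ht : 0 < t := ha.trans_le hat
  have hN : 0 ≤ N := (S.pos a ha 0).le.trans (h1 0)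
  have hκ := S.hκ
  have hM := S.hM
  have hβ := S.hβ
  simp only [Finset.sum_add_distrib, ← Finset.mul_sum]
  have e1 : ∑ i, B t i x * (σ * (pd i (ρ t) x - pd i (ρ a) x)) =
      σ * (∑ i, B t i x * pd i (ρ t) x) - σ * ∑ i, B t i x * pd i (ρ a) x := by
    rw [Finset.mul_sum, Finset.mul_sum, ← Finset.sum_sub_distrib]
    exact Finset.sum_congr rfl fun i _ => by ring
  rw [e1, Finset.sum_sub_distrib]
  have hR : |∑ i, B t i x * pd i (ρ a) x| ≤ d * (β * N) := by
    refine (Finset.abs_sum_le_sum_abs _ _).trans ?_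
    refine (Finset.sum_le_card_nsmul _ _ (β * N) fun i _ => ?_).trans (by simp)
    rw [abs_mul]
    exact mul_le_mul (S.Bbd t ht i x) (h2 i x) (abs_nonneg _) hβ
  have hY : |∑ i, pd i (pd i (ρ a)) x| ≤ d * N := by
    refine (Finset.abs_sum_le_sum_abs _ _).trans ?_
    refine (Finset.sum_le_card_nsmul _ _ N fun i _ => h3 i x).trans (by simp)
  have hQ := S.Bdiv t ht x
  set Q := ∑ i, pd i (B t i) x
  set P := ∑ i, B t i x * pd i (ρ t) x
  set R := ∑ i, B t i x * pd i (ρ a) x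
  set X := ∑ i, pd i (pd i (ρ t)) x
  set Y := ∑ i, pd i (pd i (ρ a)) x
  have hK0 : 0 ≤ K := by rw [hK]; positivity
  have b1 : σ * Y ≤ d * N := by
    calc σ * Y ≤ |σ * Y| := le_abs_self _
      _ = |Y| := by rw [abs_mul, hσ, one_mul]
      _ ≤ _ := hY
  have b2 : σ * R ≤ d * (β * N) := by
    calc σ * R ≤ |σ * R| := le_abs_self _
      _ = |R| := by rw [abs_mul, hσ, one_mul]
      _ ≤ _ := hR
  have b3 : σ * ρ a x * Q ≤ M * N := by
    calc σ * ρ a x * Q ≤ |σ * ρ a x * Q| := le_abs_self _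
      _ = ρ a x * |Q| := by rw [abs_mul, abs_mul, hσ, one_mul, abs_of_pos (S.pos a ha x)]
      _ ≤ N * M := mul_le_mul (h1 x) hQ (abs_nonneg _) hN
      _ = _ := mul_comm _ _
  have b4 : K * (t - a) * Q ≤ K * (t - a) * M :=
    mul_le_mul_of_nonneg_left ((le_abs_self _).trans hQ) (mul_nonneg hK0 (by linarith))
  have b5 : K * (κ * M * (t - a)) ≤ K * (1 / 2) := mul_le_mul_of_nonneg_left hsm hK0
  have b6 : κ * (σ * R + σ * ρ a x * Q + K * (t - a) * Q) ≤
      κ * (d * (β * N) + M * N + K * (t - a) * M) := mul_le_mul_of_nonneg_left (by linarith) hκ.le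
  have b7 : d * N + κ * (d * (β * N) + M * N) = K / 2 := by rw [hK]; ring
  nlinarith

theorem rhs_cont (S : Sol d L κ M β ρ B) {t : ℝ} (ht : 0 < t) : Continuous fun x =>
    κ * (∑ i, (ρ t x * pd i (B t i) x + B t i x * pd i (ρ t) x)) + ∑ i, pd i (pd i (ρ t)) x := by
  have hu := S.reg t ht
  have hu1 : ContDiff ℝ 1 (ρ t) := hu.of_le one_le_two
  have h0 := hu1.continuous
  have h1 := fun i => tc_pd_cont i hu1
  have h2 := fun i => tc_pd_cont i (S.B1 t ht i)
  have h3 := fun i => tc_pd_cont i (tc_pd_c1 i hu)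
  have h4 := fun i => (S.B1 t ht i).continuous
  fun_prop

theorem gap_der (S : Sol d L κ M β ρ B) {a t N σ K ε : ℝ} (hε : 0 < ε) (ha : 0 < a) (hat : a ≤ t)
    (h1 : ∀ x, ρ a x ≤ N) (h2 : ∀ i x, |pd i (ρ a) x| ≤ N) (h3 : ∀ i x, |pd i (pd i (ρ a)) x| ≤ N)
    (hsm : κ * M * (t - a) ≤ 1 / 2) (hσ : |σ| = 1)
    (hK : K = 2 * (d * N + κ * (d * (β * N) + M * N))) (hRL : RL ρ t) :
    ∃ f' ≤ κ * (ε * M * volume.real (box L d)),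
      HasDerivWithinAt (fun s => ∫ x in box L d, he ε (σ * (ρ s x - ρ a x) - K * (s - a))) f' (Set.Ici t) t := by
  have ht : 0 < t := ha.trans_le hat
  have hN : 0 ≤ N := (S.pos a ha 0).le.trans (h1 0)
  have hκ := S.hκ
  have hM := S.hM
  have hβ := S.hβ
  have hK0 : 0 ≤ K := by rw [hK]; positivity
  have := box_fin L d
  obtain ⟨C, δ, hδ, hC⟩ := hRL
  have hca := (S.reg a ha).continuous
  refine ⟨_, ?_, g_rd (q' := fun x => he1 ε (σ * (ρ t x - ρ a x) - K * (t - a)) *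
    (σ * (κ * (∑ i, (ρ t x * pd i (B t i) x + B t i x * pd i (ρ t) x)) + ∑ i, pd i (pd i (ρ t)) x) - K))
    (C := C + K) hδ ?_ ?_ ?_⟩
  · let u : (Fin d → ℝ) → ℝ := fun x => σ * (ρ t x - ρ a x) - K * (t - a)
    have hu : ContDiff ℝ 2 u := (contDiff_const.mul ((S.reg t ht).sub (S.reg a ha))).sub contDiff_const
    have hup : Per L u := fun x i => by simp only [u, S.per t ht x i, S.per a ha x i]
    have ht1 : ContDiff ℝ 1 (ρ t) := (S.reg t ht).of_le one_le_two
    have ha1 : ContDiff ℝ 1 (ρ a) := (S.reg a ha).of_le one_le_two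
    have p1 : ∀ i, pd i u = fun x => σ * (pd i (ρ t) x - pd i (ρ a) x) := fun i => funext fun x =>
      pd_aff i (ht1.differentiable one_ne_zero x) (ha1.differentiable one_ne_zero x) _ _
    have p2 : ∀ i x, pd i (pd i u) x = σ * (pd i (pd i (ρ t)) x - pd i (pd i (ρ a)) x) := fun i x => by
      rw [p1 i]
      exact pd_aff0 i ((tc_pd_c1 i (S.reg t ht)).differentiable one_ne_zero x)
        ((tc_pd_c1 i (S.reg a ha)).differentiable one_ne_zero x) _
    have hdiss := ib_diss (κ := κ) S.hL hu hup (S.B1 t ht) (S.Bper t ht) (fun x => (he_cd hε).contDiffAt)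
      (fun x => he_d hε (u x)) (fun x => (he1_cd hε).contDiffAt) (fun x => he1_d hε (u x))
    have hu1 : ContDiff ℝ 1 u := hu.of_le one_le_two
    have q0 := hu1.continuous
    have q1 := fun i => tc_pd_cont i hu1
    have q2 := fun i => tc_pd_cont i (S.B1 t ht i)
    have q3 := fun i => tc_pd_cont i (tc_pd_c1 i hu)
    have q4 := fun i => (S.B1 t ht i).continuous
    have q5 : Continuous fun x => he1 ε (u x) := (he1_cd hε).continuous.comp q0
    have q6 : Continuous fun x => he ε (u x) := (he_cd hε).continuous.comp q0
    have cont2 : Continuous fun x => (κ * (∑ i, (u x * pd i (B t i) x + B t i x * pd i u x)) + ∑ i, pd i (pd i u) x) := by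
      fun_prop
    have cont1 := ((rhs_cont S ht).const_mul σ).sub (continuous_const (y := K))
    have step1 : ∫ x in box L d, he1 ε (u x) *
        (σ * (κ * (∑ i, (ρ t x * pd i (B t i) x + B t i x * pd i (ρ t) x)) + ∑ i, pd i (pd i (ρ t)) x) - K) ≤
        ∫ x in box L d, he1 ε (u x) * (κ * (∑ i, (u x * pd i (B t i) x + B t i x * pd i u x)) + ∑ i, pd i (pd i u) x) := by
      apply setIntegral_mono (tc_int L (q5.mul cont1)) (tc_int L (q5.mul cont2))
      intro x
      simp only [Pi.mul_apply]
      refine mul_le_mul_of_nonneg_left ?_ (he1_nn hε _)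
      have := gap_pt S ha hat h1 h2 h3 hsm hσ hK x
      simp only [p2]
      simp only [p1]
      exact this
    refine step1.trans ?_
    rw [hdiss]
    have n1 : 0 ≤ ∑ i, ∫ x in box L d, he2 ε (u x) * (pd i u x) ^ 2 :=
      Finset.sum_nonneg fun i _ => integral_nonneg fun x => mul_nonneg (he2_nn _) (sq_nonneg _)
    have n2 : ∫ x in box L d, (u x * he1 ε (u x) - he ε (u x)) * ∑ i, pd i (B t i) x ≤
        ε * M * volume.real (box L d) := by
      have cc : Continuous fun x => (u x * he1 ε (u x) - he ε (u x)) * ∑ i, pd i (B t i) x :=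
        ((q0.mul q5).sub q6).mul (by fun_prop)
      have := setIntegral_mono (tc_int L cc) (tc_int L (continuous_const (y := ε * M))) (fun x => ?_)
      · refine this.trans (le_of_eq ?_)
        rw [setIntegral_const, smul_eq_mul, mul_comm]
      · simp only
        refine (le_abs_self _).trans ?_
        rw [abs_mul]
        exact mul_le_mul (he_k hε _) (S.Bdiv t ht x) (abs_nonneg _) hε.le
    have := mul_le_mul_of_nonneg_left n2 hκ.le
    linarith
  · intro s hs
    have hcs := (S.reg s (ht.trans_le hs.1)).continuous
    exact tc_int L ((he_cd hε).continuous.comp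
      ((continuous_const.mul (hcs.sub hca)).sub continuous_const))
  · intro s hs x
    refine (he_lip hε _ _).trans ?_
    have e : σ * (ρ s x - ρ a x) - K * (s - a) - (σ * (ρ t x - ρ a x) - K * (t - a)) =
      σ * (ρ s x - ρ t x) - K * (s - t) := by ring
    rw [e]
    refine (abs_sub _ _).trans ?_
    rw [abs_mul, abs_mul, hσ, one_mul, abs_of_nonneg hK0, abs_of_nonneg (sub_nonneg.2 hs.1)]
    linarith [hC s hs x]
  · intro x
    have hd := ((S.pde t ht x).sub_const (ρ a x)).const_mul σ
    have hd2 := ((hasDerivAt_id t).sub_const a).const_mul K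
    have hd3 := hd.sub hd2
    rw [mul_one] at hd3
    exact (he_d hε (σ * (ρ t x - ρ a x) - K * (t - a))).comp t hd3
end

section
variable {d : ℕ} {L κ M β : ℝ} {ρ : ℝ → (Fin d → ℝ) → ℝ} {B : ℝ → Fin d → (Fin d → ℝ) → ℝ}

theorem sol_seq (S : Sol d L κ M β ρ B) {t : ℝ} (ht : 0 ≤ t) {s : ℕ → ℝ} (hs : ∀ n, 0 ≤ s n)
    (hst : Filter.Tendsto s Filter.atTop (nhds t)) (x : Fin d → ℝ) :
    Filter.Tendsto (fun n => ρ (s n) x) Filter.atTop (nhds (ρ t x)) := by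
  have := (S.cont x) t ht
  exact this.tendsto.comp (tendsto_nhdsWithin_iff.2 ⟨hst, Filter.Eventually.of_forall hs⟩)

theorem gap_F (S : Sol d L κ M β ρ B) {a b N σ K ε : ℝ} (hε : 0 < ε) (ha : 0 < a)
    (h1 : ∀ x, ρ a x ≤ N) (h2 : ∀ i x, |pd i (ρ a) x| ≤ N) (h3 : ∀ i x, |pd i (pd i (ρ a)) x| ≤ N)
    (hsm : κ * M * (b - a) ≤ 1 / 2) (hσ : |σ| = 1)
    (hK : K = 2 * (d * N + κ * (d * (β * N) + M * N))) (hRL : ∀ t ∈ Set.Ioo a b, RL ρ t)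
    {t : ℝ} (ht : t ∈ Set.Ioo a b) :
    ∫ x in box L d, he ε (σ * (ρ t x - ρ a x) - K * (t - a)) ≤
      ε * volume.real (box L d) + κ * (ε * M * volume.real (box L d)) * (t - a) := by
  have hN : 0 ≤ N := (S.pos a ha 0).le.trans (h1 0)
  have hκ := S.hκ
  have hM := S.hM
  have hβ := S.hβ
  have hK0 : 0 ≤ K := by rw [hK]; positivity
  have hfm := box_fin L d
  have hca := (S.reg a ha).continuous
  have hci : ∀ s, 0 < s → Continuous fun x => he ε (σ * (ρ s x - ρ a x) - K * (s - a)) := fun s hs =>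
    (he_cd hε).continuous.comp
      ((continuous_const.mul ((S.reg s hs).continuous.sub hca)).sub continuous_const)
  have hlimit : ∀ (r : ℝ) (s : ℕ → ℝ), 0 ≤ r → (∀ n, 0 ≤ s n) → Filter.Tendsto s Filter.atTop (nhds r) → ∀ x,
      Filter.Tendsto (fun n => he ε (σ * (ρ (s n) x - ρ a x) - K * (s n - a))) Filter.atTop
        (nhds (he ε (σ * (ρ r x - ρ a x) - K * (r - a)))) := fun r s hr hs hsr x =>
    ((he_cd hε).continuous.tendsto _).comp
      ((((sol_seq S hr hs hsr x).sub_const _).const_mul σ).sub ((hsr.sub_const a).const_mul K))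
  have hF : ∀ s ∈ Set.Ioo a t, ∫ x in box L d, he ε (σ * (ρ t x - ρ a x) - K * (t - a)) ≤
      (∫ x in box L d, he ε (σ * (ρ s x - ρ a x) - K * (s - a))) +
        κ * (ε * M * volume.real (box L d)) * (t - s) := by
    intro s hs
    refine g_lin (F := fun s => ∫ x in box L d, he ε (σ * (ρ s x - ρ a x) - K * (s - a))) hs.2.le ?_ ?_
    · intro r hr
      have har : a < r := hs.1.trans_le hr.1
      refine gap_der S hε ha har.le h1 h2 h3 ?_ hσ hK (hRL r ⟨har, hr.2.trans ht.2⟩)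
      refine le_trans (mul_le_mul_of_nonneg_left ?_ (by positivity)) hsm
      linarith [hr.2, ht.2]
    · intro r hr w hw hwr c C hc hle
      have hr0 : 0 < r := ha.trans (hs.1.trans hr.1)
      have hw0 : ∀ n, 0 < w n := fun n => ha.trans (hs.1.trans_le (hw n).1)
      refine (g_fatou (ρn := fun n => ρ (w n)) (ρ := ρ r) (A := 0) (B := 0) (m := 1)
        (fun n => tc_int L (hci (w n) (hw0 n)))
        (fun n => tc_int L (S.reg _ (hw0 n)).continuous) (tc_int L (S.reg _ hr0).continuous)
        (fun n => S.prob _ (hw0 n)) (S.prob _ hr0) ?_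
        (hlimit r w hr0.le (fun n => (hw0 n).le) hwr) (sol_seq S hr0.le (fun n => (hw0 n).le) hwr) hle hc).2
      intro n x
      have := (le_max_right _ _).trans (he_ge hε (σ * (ρ (w n) x - ρ a x) - K * (w n - a)))
      linarith
  obtain ⟨w, -, hw, hwa⟩ := exists_seq_strictAnti_tendsto' ht.1
  have hw0 : ∀ n, 0 < w n := fun n => ha.trans (hw n).1
  have key := (g_fatou (Gn := fun n x => - he ε (σ * (ρ (w n) x - ρ a x) - K * (w n - a)))
    (G := fun x => - he ε (σ * (ρ a x - ρ a x) - K * (a - a)))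
    (ρn := fun n => ρ (w n)) (ρ := ρ a) (A := N + K * (t - a) + ε) (B := 1) (m := 1)
    (cn := fun n => - (∫ x in box L d, he ε (σ * (ρ t x - ρ a x) - K * (t - a))) +
      κ * (ε * M * volume.real (box L d)) * (t - w n))
    (c := - (∫ x in box L d, he ε (σ * (ρ t x - ρ a x) - K * (t - a))) +
      κ * (ε * M * volume.real (box L d)) * (t - a))
    (μ := volume.restrict (box L d))
    (fun n => (tc_int L (hci (w n) (hw0 n))).neg)
    (fun n => tc_int L (S.reg _ (hw0 n)).continuous) (tc_int L (S.reg _ ha).continuous)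
    (fun n => S.prob _ (hw0 n)) (S.prob _ ha) ?_
    (fun x => (hlimit a w ha.le (fun n => (hw0 n).le) hwa x).neg)
    (sol_seq S ha.le (fun n => (hw0 n).le) hwa) ?_ ?_).2
  · have e : ∀ x, - he ε (σ * (ρ a x - ρ a x) - K * (a - a)) = - he ε 0 := fun x => by simp
    simp_rw [e] at key
    rw [setIntegral_const, smul_eq_mul] at key
    have := he_le hε 0
    rw [abs_zero, zero_add] at this
    have hv : 0 ≤ volume.real (box L d) := measureReal_nonneg
    nlinarith
  · intro n x
    have b1 := he_le hε (σ * (ρ (w n) x - ρ a x) - K * (w n - a))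
    have b2 := abs_sub (σ * (ρ (w n) x - ρ a x)) (K * (w n - a))
    rw [abs_mul, hσ, one_mul, abs_mul, abs_of_nonneg hK0, abs_of_pos (sub_pos.2 (hw n).1)] at b2
    have b3 : |ρ (w n) x - ρ a x| ≤ ρ (w n) x + N := by
      rw [abs_le]
      constructor <;> linarith [h1 x, S.pos a ha x, S.pos _ (hw0 n) x]
    have b4 : K * (w n - a) ≤ K * (t - a) := mul_le_mul_of_nonneg_left (by linarith [(hw n).2]) hK0
    linarith
  · intro n
    rw [integral_neg]
    linarith [hF (w n) (hw n)]
  · exact ((hwa.const_sub t).const_mul _).const_add _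

theorem gap_one (S : Sol d L κ M β ρ B) {a b N σ K : ℝ} (ha : 0 < a)
    (h1 : ∀ x, ρ a x ≤ N) (h2 : ∀ i x, |pd i (ρ a) x| ≤ N) (h3 : ∀ i x, |pd i (pd i (ρ a)) x| ≤ N)
    (hsm : κ * M * (b - a) ≤ 1 / 2) (hσ : |σ| = 1)
    (hK : K = 2 * (d * N + κ * (d * (β * N) + M * N))) (hRL : ∀ t ∈ Set.Ioo a b, RL ρ t)
    {t : ℝ} (ht : t ∈ Set.Ioo a b) (x : Fin d → ℝ) : σ * (ρ t x - ρ a x) ≤ K * (t - a) := by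
  have ht0 : 0 < t := ha.trans ht.1
  have hc : Continuous fun x => max (σ * (ρ t x - ρ a x) - K * (t - a)) 0 := by
    have h1 := (S.reg t ht0).continuous
    have h2 := (S.reg a ha).continuous
    fun_prop
  have hz := ib_zero S.hL hc (fun x i => by simp only [S.per t ht0 x i, S.per a ha x i])
    (fun x => le_max_right _ _) ?_ x
  · have := le_max_left (σ * (ρ t x - ρ a x) - K * (t - a)) 0
    rw [hz] at this; linarith
  · apply le_of_forall_pos_le_add
    intro η hη
    set V := volume.real (box L d) with hV
    have hv : 0 ≤ V := measureReal_nonneg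
    have hW : 0 ≤ V + κ * M * V * (t - a) := by
      have := S.hκ; have := S.hM; have : 0 ≤ t - a := by linarith [ht.1]
      positivity
    set W := V + κ * M * V * (t - a) with hWd
    have hε : 0 < η / (W + 1) := by positivity
    have hF := gap_F S hε ha h1 h2 h3 hsm hσ hK hRL ht
    have hm := setIntegral_mono (tc_int L hc) (tc_int L (f := fun x => he (η / (W + 1)) (σ * (ρ t x - ρ a x) - K * (t - a)))
      ((he_cd hε).continuous.comp
        ((continuous_const.mul ((S.reg t ht0).continuous.sub (S.reg a ha).continuous)).sub continuous_const)))
      (fun x => he_ge hε _)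
    refine hm.trans (hF.trans ?_)
    have : η / (W + 1) * V + κ * (η / (W + 1) * M * V) * (t - a) = η / (W + 1) * W := by rw [hWd]; ring
    rw [← hV, this, zero_add, div_mul_eq_mul_div, div_le_iff₀ (by linarith)]
    nlinarith

theorem gap (S : Sol d L κ M β ρ B) {a b N K : ℝ} (ha : 0 < a)
    (h1 : ∀ x, ρ a x ≤ N) (h2 : ∀ i x, |pd i (ρ a) x| ≤ N) (h3 : ∀ i x, |pd i (pd i (ρ a)) x| ≤ N)
    (hsm : κ * M * (b - a) ≤ 1 / 2)
    (hK : K = 2 * (d * N + κ * (d * (β * N) + M * N))) (hRL : ∀ t ∈ Set.Ioo a b, RL ρ t)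
    {t : ℝ} (ht : t ∈ Set.Ioo a b) (x : Fin d → ℝ) : |ρ t x - ρ a x| ≤ K * (t - a) := by
  have p := gap_one S ha h1 h2 h3 hsm (σ := 1) (by simp) hK hRL ht x
  have m := gap_one S ha h1 h2 h3 hsm (σ := -1) (by simp) hK hRL ht x
  rw [abs_le]; constructor <;> linarith
end

def AN {d : ℕ} (N : ℝ) (f : (Fin d → ℝ) → ℝ) : Prop :=
  (∀ x, f x ≤ N) ∧
  (∀ (i : Fin d) x (h : ℝ), |f (x + h • (Pi.single i 1 : Fin d → ℝ)) - f x| ≤ N * |h|) ∧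
  (∀ (i : Fin d) x (h : ℝ), |f (x + h • (Pi.single i 1 : Fin d → ℝ)) + f (x + (-h) • (Pi.single i 1 : Fin d → ℝ))
    - 2 * f x| ≤ N * h ^ 2)

theorem an_mono {d : ℕ} {N N' : ℝ} {f : (Fin d → ℝ) → ℝ} (h : AN N f) (hN : N ≤ N') : AN N' f :=
  ⟨fun x => (h.1 x).trans hN, fun i x r => (h.2.1 i x r).trans (mul_le_mul_of_nonneg_right hN (abs_nonneg _)),
    fun i x r => (h.2.2 i x r).trans (mul_le_mul_of_nonneg_right hN (sq_nonneg _))⟩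

theorem line_neg {d : ℕ} (i : Fin d) {f : (Fin d → ℝ) → ℝ} (hf : Differentiable ℝ f) (x : Fin d → ℝ) (s : ℝ) :
    HasDerivAt (fun s : ℝ => f (x + (-s) • (Pi.single i 1 : Fin d → ℝ)))
      (- pd i f (x + (-s) • (Pi.single i 1 : Fin d → ℝ))) s := by
  have h := tc_line i hf x (-s)
  have := h.scomp s (hasDerivAt_neg s)
  rw [neg_one_smul] at this
  exact this

theorem an_exists {d : ℕ} {L : ℝ} (hL : 0 < L) {f : (Fin d → ℝ) → ℝ} (hf : ContDiff ℝ 2 f) (hp : Per L f) :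
    ∃ N : ℕ, AN N f := by
  have hf1 : ContDiff ℝ 1 f := hf.of_le one_le_two
  have hfd := hf1.differentiable one_ne_zero
  obtain ⟨C0, hC0, h0⟩ := tc_bdd hL hf.continuous hp
  choose C1 hC1 h1 using fun i => tc_bdd hL (tc_pd_cont i hf1) (tc_per_pd i hp)
  choose C2 hC2 h2 using fun i => tc_bdd hL (tc_pd_cont i (tc_pd_c1 i hf)) (tc_per_pd i (tc_per_pd i hp))
  have hs1 : ∀ i, C1 i ≤ ∑ j, C1 j := fun i => Finset.single_le_sum (fun j _ => hC1 j) (Finset.mem_univ i)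
  have hs2 : ∀ i, C2 i ≤ ∑ j, C2 j := fun i => Finset.single_le_sum (fun j _ => hC2 j) (Finset.mem_univ i)
  have p1 : 0 ≤ ∑ j, C1 j := Finset.sum_nonneg fun j _ => hC1 j
  have p2 : 0 ≤ ∑ j, C2 j := Finset.sum_nonneg fun j _ => hC2 j
  obtain ⟨N, hN⟩ := exists_nat_ge (C0 + ∑ j, C1 j + 2 * ∑ j, C2 j)
  have lip : ∀ (g : (Fin d → ℝ) → ℝ) (i : Fin d) (C : ℝ), Differentiable ℝ g → (∀ x, |pd i g x| ≤ C) →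
      ∀ x (a b : ℝ), |g (x + a • (Pi.single i 1 : Fin d → ℝ)) - g (x + b • (Pi.single i 1 : Fin d → ℝ))| ≤ C * |a - b| := by
    intro g i C hg hb x a b
    have := Convex.norm_image_sub_le_of_norm_hasDerivWithin_le (s := Set.univ) (C := C)
      (fun s _ => (tc_line i hg x s).hasDerivWithinAt) (fun s _ => hb _) convex_univ (Set.mem_univ b) (Set.mem_univ a)
    exact this
  refine ⟨N, fun x => ?_, fun i x h => ?_, fun i x h => ?_⟩
  · linarith [(le_abs_self _).trans (h0 x)]
  · have := lip f i (C1 i) hfd (h1 i) x h 0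
    rw [zero_smul, add_zero, sub_zero] at this
    refine this.trans (mul_le_mul_of_nonneg_right ?_ (abs_nonneg _))
    linarith [hs1 i]
  · have hd : ∀ s, HasDerivAt (fun s : ℝ => f (x + s • (Pi.single i 1 : Fin d → ℝ)) + f (x + (-s) • (Pi.single i 1 : Fin d → ℝ)))
        (pd i f (x + s • (Pi.single i 1 : Fin d → ℝ)) + - pd i f (x + (-s) • (Pi.single i 1 : Fin d → ℝ))) s :=
      fun s => (tc_line i hfd x s).add (line_neg i hfd x s)
    have := Convex.norm_image_sub_le_of_norm_hasDerivWithin_le (s := Set.Icc (-|h|) |h|) (C := C2 i * (2 * |h|)) (x := 0) (y := h)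
      (fun s _ => (hd s).hasDerivWithinAt) (fun s hs => ?_) (convex_Icc _ _) ⟨by simp, by simp⟩
      ⟨neg_abs_le h, le_abs_self h⟩
    · simp only [zero_smul, add_zero, neg_zero, sub_zero, Real.norm_eq_abs] at this
      rw [two_mul (f x)]
      refine this.trans ?_
      rw [← sq_abs h]
      have := hs2 i
      have := abs_nonneg h
      nlinarith [mul_nonneg this this]
    · have := lip (pd i f) i (C2 i) ((tc_pd_c1 i hf).differentiable one_ne_zero) (h2 i) x s (-s)
      rw [Real.norm_eq_abs, ← sub_eq_add_neg]
      refine this.trans (mul_le_mul_of_nonneg_left ?_ (hC2 i))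
      rw [sub_neg_eq_add, ← two_mul, abs_mul, abs_two]
      have : |s| ≤ |h| := abs_le.2 hs
      linarith

theorem an_pd {d : ℕ} {N : ℝ} (hN : 0 ≤ N) {f : (Fin d → ℝ) → ℝ} (hf : ContDiff ℝ 2 f) (hA : AN N f)
    (i : Fin d) (x : Fin d → ℝ) : |pd i f x| ≤ N := by
  have hf1 : ContDiff ℝ 1 f := hf.of_le one_le_two
  have hfd := hf1.differentiable one_ne_zero
  have h := tc_line i hfd x 0
  have := h.le_of_lip' hN (Filter.Eventually.of_forall fun s => by
    simpa using hA.2.1 i x s)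
  simpa using this

theorem an_pd2 {d : ℕ} {N : ℝ} {f : (Fin d → ℝ) → ℝ} (hf : ContDiff ℝ 2 f) (hA : AN N f)
    (i : Fin d) (x : Fin d → ℝ) : |pd i (pd i f) x| ≤ N := by
  have hf1 : ContDiff ℝ 1 f := hf.of_le one_le_two
  have hfd := hf1.differentiable one_ne_zero
  have hfd2 := (tc_pd_c1 i hf).differentiable one_ne_zero
  have key : ∀ σ : ℝ, |σ| = 1 → σ * pd i (pd i f) x ≤ N := by
    intro σ hσ
    by_contra hcon
    push Not at hcon
    let χ : ℝ → ℝ := fun s => σ * (f (x + s • (Pi.single i 1 : Fin d → ℝ)) + f (x + (-s) • (Pi.single i 1 : Fin d → ℝ))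
      - 2 * f x) - N * s ^ 2
    have hd : ∀ s, HasDerivAt χ (σ * (pd i f (x + s • (Pi.single i 1 : Fin d → ℝ)) +
        - pd i f (x + (-s) • (Pi.single i 1 : Fin d → ℝ))) - N * (2 * s)) s := fun s => by
      have h1 := (((tc_line i hfd x s).add (line_neg i hfd x s)).sub_const (2 * f x)).const_mul σ
      have h2 : HasDerivAt (fun s : ℝ => N * s ^ 2) (N * (2 * s)) s := by
        simpa using (hasDerivAt_pow 2 s).const_mul N
      exact h1.sub h2
    have e1 : deriv χ = fun s => σ * (pd i f (x + s • (Pi.single i 1 : Fin d → ℝ)) +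
        - pd i f (x + (-s) • (Pi.single i 1 : Fin d → ℝ))) - N * (2 * s) := funext fun s => (hd s).deriv
    have e2 : deriv (deriv χ) 0 = 2 * (σ * pd i (pd i f) x - N) := by
      rw [e1]
      have h1 := ((tc_line i hfd2 x 0).add (line_neg i hfd2 x 0).neg).const_mul σ
      have h2 : HasDerivAt (fun s : ℝ => N * (2 * s)) (N * (2 * 1)) 0 :=
        ((hasDerivAt_id (0:ℝ)).const_mul 2).const_mul N
      refine (h1.sub h2).deriv.trans ?_
      simp; ring
    have hmin : IsLocalMin χ 0 := isLocalMin_of_deriv_deriv_pos (by rw [e2]; linarith)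
      (by rw [e1]; simp) (hd 0).continuousAt
    have hχ0 : χ 0 = 0 := by simp [χ]; ring_nf; simp
    have hχ : χ =ᶠ[nhds 0] fun _ => 0 := by
      filter_upwards [hmin] with s hs
      apply le_antisymm
      · have := hA.2.2 i x s
        have h2 : σ * (f (x + s • (Pi.single i 1 : Fin d → ℝ)) + f (x + (-s) • (Pi.single i 1 : Fin d → ℝ))
          - 2 * f x) ≤ N * s ^ 2 := by
          refine (le_abs_self _).trans ?_
          rw [abs_mul, hσ, one_mul]; exact this
        simp only [χ]; linarith
      · rw [← hχ0]; exact hs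
    have := hχ.deriv.deriv_eq
    rw [e2] at this
    simp at this
    linarith
  rw [abs_le]
  have p := key 1 (by simp)
  have m := key (-1) (by simp)
  constructor <;> linarith

section
variable {d : ℕ} {L κ M β : ℝ} {ρ : ℝ → (Fin d → ℝ) → ℝ} {B : ℝ → Fin d → (Fin d → ℝ) → ℝ}

theorem rhs_bd (S : Sol d L κ M β ρ B) {t N : ℝ} (ht : 0 < t)
    (h1 : ∀ x, ρ t x ≤ N) (h2 : ∀ i x, |pd i (ρ t) x| ≤ N) (h3 : ∀ i x, |pd i (pd i (ρ t)) x| ≤ N)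
    (x : Fin d → ℝ) :
    |κ * (∑ i, (ρ t x * pd i (B t i) x + B t i x * pd i (ρ t) x)) + ∑ i, pd i (pd i (ρ t)) x| ≤
      d * N + κ * (d * (β * N) + M * N) := by
  have hN : 0 ≤ N := (S.pos t ht 0).le.trans (h1 0)
  have hκ := S.hκ
  have hR : |∑ i, B t i x * pd i (ρ t) x| ≤ d * (β * N) := by
    refine (Finset.abs_sum_le_sum_abs _ _).trans ?_
    refine (Finset.sum_le_card_nsmul _ _ (β * N) fun i _ => ?_).trans (by simp)
    rw [abs_mul]
    exact mul_le_mul (S.Bbd t ht i x) (h2 i x) (abs_nonneg _) S.hβ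
  have hY : |∑ i, pd i (pd i (ρ t)) x| ≤ d * N := by
    refine (Finset.abs_sum_le_sum_abs _ _).trans ?_
    refine (Finset.sum_le_card_nsmul _ _ N fun i _ => h3 i x).trans (by simp)
  have hQ : |ρ t x * ∑ i, pd i (B t i) x| ≤ M * N := by
    rw [abs_mul, abs_of_pos (S.pos t ht x), mul_comm]
    exact mul_le_mul (S.Bdiv t ht x) (h1 x) (S.pos t ht x).le S.hM
  rw [Finset.sum_add_distrib, ← Finset.mul_sum]
  refine (abs_add_le _ _).trans ?_
  rw [abs_mul, abs_of_pos hκ]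
  have := abs_add_le (ρ t x * ∑ i, pd i (B t i) x) (∑ i, B t i x * pd i (ρ t) x)
  have h4 := mul_le_mul_of_nonneg_left (this.trans (add_le_add hQ hR)) hκ.le
  linarith

theorem baire_pt (S : Sol d L κ M β ρ B) {E : Set ℝ} (hE : IsClosed E) {r q N K : ℝ} (hr : 0 < r)
    (hrE : r ∈ E) (hN : ∀ s ∈ E, r ≤ s → s < q → AN N (ρ s)) (hRL : ∀ s, r ≤ s → s ∉ E → RL ρ s)
    (hsm : κ * M * (q - r) ≤ 1 / 2) (hK : K = 2 * (d * N + κ * (d * (β * N) + M * N))) (hrq : r < q)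
    (x : Fin d → ℝ) : ∀ τ ∈ Set.Ico r q, |ρ τ x - ρ r x| ≤ (K + 1) * (τ - r) := by
  have hN0 : 0 ≤ N := (S.pos r hr 0).le.trans ((hN r hrE le_rfl hrq).1 0)
  have hκ := S.hκ
  have hM := S.hM
  have hβ := S.hβ
  have hK0 : 0 ≤ K := by rw [hK]; positivity
  by_contra hcon
  push Not at hcon
  obtain ⟨t0, ht0, hft0⟩ := hcon
  let V : Set ℝ := {τ | τ ∈ Set.Ico r q ∧ (K + 1) * (τ - r) < |ρ τ x - ρ r x|}
  have hVne : V.Nonempty := ⟨t0, ht0, hft0⟩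
  have hVbdd : BddBelow V := ⟨r, fun t ht => ht.1.1⟩
  set T := sInf V with hT
  have hrT : r ≤ T := le_csInf hVne fun t ht => ht.1.1
  have hT0 : 0 < T := hr.trans_le hrT
  have hTq : T < q := (csInf_le hVbdd ⟨ht0, hft0⟩).trans_lt ht0.2
  have hbef : ∀ s ∈ Set.Ico r T, |ρ s x - ρ r x| ≤ (K + 1) * (s - r) := by
    intro s hs
    by_contra h
    push Not at h
    have : T ≤ s := csInf_le hVbdd ⟨⟨hs.1, hs.2.trans hTq⟩, h⟩
    linarith [hs.2]
  have hcT : ContinuousAt (fun s => ρ s x) T := (S.pde T hT0 x).continuousAt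
  have hfT : |ρ T x - ρ r x| ≤ (K + 1) * (T - r) := by
    rcases hrT.eq_or_lt with h | h
    · rw [← h]; simp
    · have l1 : Filter.Tendsto (fun s => |ρ s x - ρ r x|) (nhdsWithin T (Set.Iio T)) (nhds |ρ T x - ρ r x|) :=
        ((hcT.sub continuousAt_const).abs).tendsto.mono_left nhdsWithin_le_nhds
      have l2 : Filter.Tendsto (fun s => (K + 1) * (s - r)) (nhdsWithin T (Set.Iio T)) (nhds ((K + 1) * (T - r))) :=
        (Continuous.tendsto (by fun_prop) T).mono_left nhdsWithin_le_nhds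
      refine le_of_tendsto_of_tendsto l1 l2 ?_
      filter_upwards [Ioo_mem_nhdsLT h] with s hs
      exact hbef s ⟨hs.1.le, hs.2⟩
  have hle : ∀ s ∈ Set.Icc r T, |ρ s x - ρ r x| ≤ (K + 1) * (s - r) := fun s hs => by
    rcases hs.2.eq_or_lt with h | h
    · rw [h]; exact hfT
    · exact hbef s ⟨hs.1, h⟩
  suffices hs : ∃ u > T, ∀ τ ∈ Set.Ioo T u, τ < q → |ρ τ x - ρ r x| ≤ (K + 1) * (τ - r) by
    obtain ⟨u, hu, hu2⟩ := hs
    have : u ≤ T := by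
      apply le_csInf hVne
      intro t ht
      by_contra hlt
      push Not at hlt
      have hTt : T ≤ t := csInf_le hVbdd ht
      rcases hTt.eq_or_lt with h | h
      · have := ht.2; rw [← h] at this; linarith
      · have := hu2 t ⟨h, hlt⟩ ht.1.2
        linarith [ht.2]
    linarith
  by_cases hTE : T ∈ E
  · have hA := hN T hTE hrT hTq
    have hb := rhs_bd S hT0 hA.1 (an_pd hN0 (S.reg T hT0) hA) (an_pd2 (S.reg T hT0) hA) x
    have hder := (S.pde T hT0 x).hasDerivWithinAt (s := Set.Ioi T)
    rw [hasDerivWithinAt_iff_tendsto_slope' (by simp)] at hder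
    have hlt : |κ * (∑ i, (ρ T x * pd i (B T i) x + B T i x * pd i (ρ T) x)) + ∑ i, pd i (pd i (ρ T)) x| < K + 1 := by
      have : d * N + κ * (d * (β * N) + M * N) = K / 2 := by rw [hK]; ring
      linarith
    have hev := hder.abs.eventually (gt_mem_nhds hlt)
    obtain ⟨u, hu, hu2⟩ := mem_nhdsGT_iff_exists_Ioo_subset.1 hev
    refine ⟨u, hu, fun τ hτ _ => ?_⟩
    have h1 : |slope (fun s => ρ s x) T τ| < K + 1 := hu2 hτ
    have hp : 0 < τ - T := by linarith [hτ.1]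
    rw [slope_def_field, abs_div, abs_of_pos hp, div_lt_iff₀ hp] at h1
    have h2 := abs_sub_le (ρ τ x) (ρ T x) (ρ r x)
    linarith
  · obtain ⟨a, ⟨haE, har⟩, hamax⟩ : ∃ a, IsGreatest (E ∩ Set.Icc r T) a :=
      (isCompact_Icc.inter_left hE).exists_isGreatest ⟨r, hrE, le_rfl, hrT⟩
    have haT : a < T := lt_of_le_of_ne har.2 fun h => hTE (h ▸ haE)
    obtain ⟨η, hη, hball⟩ := Metric.isOpen_iff.1 hE.isOpen_compl T hTE
    have hno : ∀ s ∈ Set.Ioo a (T + η), s ∉ E := by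
      intro s hs hsE
      rcases le_or_gt s T with h | h
      · exact absurd (hamax ⟨hsE, har.1.trans hs.1.le, h⟩) (not_le.2 hs.1)
      · refine hball ?_ hsE
        rw [Metric.mem_ball, Real.dist_eq, abs_of_pos (by linarith)]
        linarith [hs.2]
    have ha0 : 0 < a := hr.trans_le har.1
    have hA := hN a haE har.1 (haT.trans hTq)
    refine ⟨T + η, by linarith, fun τ hτ hτq => ?_⟩
    have hg := gap S (b := min (T + η) q) ha0 hA.1 (an_pd hN0 (S.reg a ha0) hA) (an_pd2 (S.reg a ha0) hA)
      (le_trans (mul_le_mul_of_nonneg_left (by linarith [min_le_right (T + η) q, har.1]) (by positivity)) hsm) hK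
      (fun s hs => hRL s (har.1.trans hs.1.le) (hno s ⟨hs.1, hs.2.trans_le (min_le_left _ _)⟩))
      (t := τ) ⟨haT.trans hτ.1, lt_min hτ.2 hτq⟩ x
    have h2 := abs_sub_le (ρ τ x) (ρ a x) (ρ r x)
    have h3 := hle a har
    have h4 := hτ.1
    nlinarith

theorem RL_all (S : Sol d L κ M β ρ B) {t0 : ℝ} (ht0 : 0 < t0) : RL ρ t0 := by
  let W : Set ℝ := {s | ∃ ε > 0, ∀ r, |r - s| < ε → t0 ≤ r → RL ρ r}
  have hWo : IsOpen W := by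
    rw [Metric.isOpen_iff]
    rintro s ⟨ε, hε, h⟩
    refine ⟨ε / 2, by positivity, fun s' hs' => ⟨ε / 2, by positivity, fun r hr => h r ?_⟩⟩
    rw [Metric.mem_ball, Real.dist_eq] at hs'
    linarith [abs_sub_le r s' s]
  have hWRL : ∀ s ∈ W, t0 ≤ s → RL ρ s := fun s ⟨ε, hε, h⟩ hs => h s (by simpa using hε) hs
  by_contra hcon
  have hE : IsClosed Wᶜ := hWo.isClosed_compl
  have hEt : ∀ s ∈ Wᶜ, t0 ≤ s := by
    intro s hs
    by_contra h
    push Not at h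
    exact hs ⟨t0 - s, by linarith, fun r hr hr2 => by
      have := (abs_lt.1 hr).2; linarith⟩
  have hne : Nonempty (Wᶜ : Set ℝ) := ⟨⟨t0, fun h => hcon (hWRL t0 h le_rfl)⟩⟩
  have hcomp : CompleteSpace (Wᶜ : Set ℝ) := hE.completeSpace_coe
  have hce : ∀ x, Continuous fun e : (Wᶜ : Set ℝ) => ρ e x := fun x => by
    rw [continuous_iff_continuousAt]
    intro e
    exact ContinuousAt.comp (f := fun e : (Wᶜ : Set ℝ) => (e : ℝ)) (g := fun s => ρ s x)
      (S.pde e (ht0.trans_le (hEt e e.2)) x).continuousAt continuous_subtype_val.continuousAt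
  obtain ⟨N, e0, he0⟩ := nonempty_interior_of_iUnion_of_closed
    (f := fun N : ℕ => {e : (Wᶜ : Set ℝ) | AN (N : ℝ) (ρ e)}) (fun N => by
      unfold AN
      simp only [Set.ofPred_and, Set.ofPred_forall]
      refine IsClosed.inter (isClosed_iInter fun x => isClosed_le (hce x) continuous_const)
        (IsClosed.inter (isClosed_iInter fun i => isClosed_iInter fun x => isClosed_iInter fun h => ?_)
        (isClosed_iInter fun i => isClosed_iInter fun x => isClosed_iInter fun h => ?_))
      · exact isClosed_le ((hce _).sub (hce _)).abs continuous_const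
      · exact isClosed_le (((hce _).add (hce _)).sub (continuous_const.mul (hce _))).abs continuous_const)
    (by
      rw [Set.eq_univ_iff_forall]
      intro e
      have h0 : 0 < (e : ℝ) := ht0.trans_le (hEt e e.2)
      obtain ⟨N, hN⟩ := an_exists S.hL (S.reg e h0) (S.per e h0)
      exact Set.mem_iUnion.2 ⟨N, hN⟩)
  obtain ⟨ε, hε, hball⟩ := Metric.mem_nhds_iff.1 (mem_interior_iff_mem_nhds.1 he0)
  have hκM : 0 ≤ κ * M := mul_nonneg S.hκ.le S.hM
  let ε1 := min ε (1 / (4 * (κ * M + 1)))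
  have hε1 : 0 < ε1 := lt_min hε (by positivity)
  have hsm : κ * M * (2 * ε1) ≤ 1 / 2 := by
    have : ε1 ≤ 1 / (4 * (κ * M + 1)) := min_le_right _ _
    rw [le_div_iff₀ (by positivity)] at this
    nlinarith
  refine e0.2 ⟨ε1, hε1, fun r hr hr0 => ?_⟩
  by_cases hrW : r ∈ W
  · exact hWRL r hrW hr0
  have hrl := abs_lt.1 hr
  refine ⟨_, (e0 : ℝ) + ε1 - r, by linarith, fun s hs x => baire_pt S hE (ht0.trans_le hr0) (q := e0 + ε1) (N := N)
    hrW ?_ ?_ ?_ rfl (by linarith) x s ⟨hs.1, by linarith [hs.2]⟩⟩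
  · intro s hsE hrs hsq
    have : (⟨s, hsE⟩ : (Wᶜ : Set ℝ)) ∈ Metric.ball e0 ε := by
      rw [Metric.mem_ball, Subtype.dist_eq, Real.dist_eq]
      exact lt_of_lt_of_le (abs_lt.2 ⟨by linarith, by linarith⟩) (min_le_left _ _ : ε1 ≤ ε)
    exact hball this
  · intro s hrs hsE
    exact hWRL s (not_not.1 hsE) (hr0.trans hrs)
  · refine le_trans (mul_le_mul_of_nonneg_left (by linarith) hκM) hsm
end

theorem pk_der {z : ℝ} (hz : 0 < z) : HasDerivAt (fun z : ℝ => Real.log z - (z - 1) * (5 * z + 1) / (2 * z * (z + 2)))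
    ((z - 1) ^ 3 / (z ^ 2 * (z + 2) ^ 2)) z := by
  have h1 : HasDerivAt (fun z : ℝ => (z - 1) * (5 * z + 1)) (1 * (5 * z + 1) + (z - 1) * (5 * 1)) z :=
    ((hasDerivAt_id z).sub_const 1).mul (((hasDerivAt_id z).const_mul 5).add_const 1)
  have h2 : HasDerivAt (fun z : ℝ => 2 * z * (z + 2)) (2 * 1 * (z + 2) + 2 * z * 1) z :=
    ((hasDerivAt_id z).const_mul 2).mul ((hasDerivAt_id z).add_const 2)
  have h0 : 2 * z * (z + 2) ≠ 0 := by positivity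
  have := (Real.hasDerivAt_log hz.ne').sub (h1.div h2 h0)
  refine HasDerivAt.congr_deriv this ?_
  have hz0 : z ≠ 0 := hz.ne'
  have hz2 : z + 2 ≠ 0 := by positivity
  rw [inv_eq_one_div, div_sub_div _ _ hz0 (by positivity), div_eq_div_iff (by positivity) (by positivity)]
  ring

theorem pk_log {z : ℝ} (hz : 0 < z) : (z - 1) * (5 * z + 1) / (2 * z * (z + 2)) ≤ Real.log z := by
  let f : ℝ → ℝ := fun z : ℝ => Real.log z - (z - 1) * (5 * z + 1) / (2 * z * (z + 2))
  have hf1 : f 1 = 0 := by simp [f]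
  suffices 0 ≤ f z by simp only [f] at this; linarith
  rw [← hf1]
  rcases le_total 1 z with h | h
  · have : MonotoneOn f (Set.Ici 1) := by
      apply monotoneOn_of_deriv_nonneg (convex_Ici 1)
      · intro x hx
        have hx : (1:ℝ) ≤ x := hx
        exact (pk_der (by linarith)).continuousAt.continuousWithinAt
      · intro x hx
        rw [interior_Ici] at hx
        have hx : (1:ℝ) < x := hx
        exact (pk_der (by linarith)).differentiableAt.differentiableWithinAt
      · intro x hx
        rw [interior_Ici] at hx
        have hx : (1:ℝ) < x := hx
        rw [(pk_der (by linarith)).deriv]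
        have : 0 ≤ x - 1 := by linarith
        positivity
    exact this (Set.mem_Ici.2 le_rfl) h h
  · have : AntitoneOn f (Set.Ioc 0 1) := by
      apply antitoneOn_of_deriv_nonpos (convex_Ioc 0 1)
      · intro x hx
        exact (pk_der hx.1).continuousAt.continuousWithinAt
      · intro x hx
        rw [interior_Ioc] at hx
        exact (pk_der hx.1).differentiableAt.differentiableWithinAt
      · intro x hx
        rw [interior_Ioc] at hx
        rw [(pk_der hx.1).deriv]
        apply div_nonpos_of_nonpos_of_nonneg
        · apply Odd.pow_nonpos (by decide)
          linarith [hx.2]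
        · positivity
    exact this ⟨hz, h⟩ ⟨one_pos, le_rfl⟩ h

theorem pk_ineq {z : ℝ} (hz : 0 < z) : 3 * (z - 1) ^ 2 ≤ (2 * z + 4) * (z * Real.log z - z + 1) := by
  have := pk_log hz
  rw [div_le_iff₀ (by positivity)] at this
  nlinarith

/-- pointwise bound -/
theorem pk_pt {z l : ℝ} (hz : 0 < z) (hl : 0 < l) :
    |z - 1| ≤ (l * (2 * z + 4) / 3 + (z * Real.log z - z + 1) / l) / 2 := by
  have h := pk_ineq hz
  set p := z * Real.log z - z + 1
  have hp : 0 ≤ p := by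
    by_contra hc
    push Not at hc
    nlinarith [sq_nonneg (z - 1)]
  set A := l * (2 * z + 4) / 3
  set Q := p / l
  have hA : 0 ≤ A := by positivity
  have hQ : 0 ≤ Q := by positivity
  have hAQ : (z - 1) ^ 2 ≤ A * Q := by
    have : A * Q = (2 * z + 4) * p / 3 := by simp only [A, Q]; field_simp
    rw [this]; linarith
  apply abs_le_of_sq_le_sq _ (by positivity)
  nlinarith [sq_nonneg (A - Q)]

theorem pinsker {d : ℕ} {L : ℝ} (hL : 0 < L) {ρ : (Fin d → ℝ) → ℝ} (hρ : Continuous ρ)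
    (hpos : ∀ x, 0 < ρ x) (hint : ∫ x in box L d, ρ x = 1) :
    (∫ x in box L d, |ρ x - 1 / L ^ d|) ^ 2 ≤ 2 * relEnt L ρ := by
  have hc : 0 < L ^ d := pow_pos hL d
  set c := L ^ d with hcdef
  have hlog : Continuous (fun x => ρ x * Real.log (ρ x * c)) :=
    hρ.mul ((hρ.mul continuous_const).log (fun x => (mul_pos (hpos x) hc).ne'))
  have hI1 := tc_int (d := d) L hρ
  have hI2 := tc_int (d := d) L hlog
  have hIc : ∀ k : ℝ, ∫ x in box L d, k = c * k := fun k => by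
    rw [setIntegral_const, tc_vol hL, smul_eq_mul]
  have hk (k : ℝ) : IntegrableOn (fun _ : Fin d → ℝ => k) (box L d) := tc_int L continuous_const
  have hPhi : ∫ x in box L d, (ρ x * Real.log (ρ x * c) - ρ x + 1 / c) = relEnt L ρ := by
    have k1 : IntegrableOn (fun x => ρ x * Real.log (ρ x * c) - ρ x) (box L d) := hI2.sub hI1
    rw [integral_add k1 (hk _), integral_sub hI2 hI1, hIc, hint]
    unfold relEnt
    field_simp; ring
  set a := ∫ x in box L d, |ρ x - 1 / c| with ha
  have hIw := tc_int (d := d) L (f := fun x => |ρ x - 1 / c|) (by fun_prop)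
  have hP : IntegrableOn (fun x => ρ x * Real.log (ρ x * c) - ρ x + 1 / c) (box L d) :=
    (hI2.sub hI1).add (hk _)
  have key : ∀ l : ℝ, 0 < l → a ≤ l + relEnt L ρ / (2 * l) := by
    intro l hl
    have k1 : IntegrableOn (fun x => l / 3 * ρ x + (2 * l / (3 * c))) (box L d) := (hI1.const_mul _).add (hk _)
    have k2 : IntegrableOn (fun x => (l / 3 * ρ x + (2 * l / (3 * c))) + 1 / (2 * l) * (ρ x * Real.log (ρ x * c) - ρ x + 1 / c)) (box L d) :=
      k1.add (hP.const_mul _)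
    have : a ≤ ∫ x in box L d, ((l / 3 * ρ x + (2 * l / (3 * c))) + 1 / (2 * l) * (ρ x * Real.log (ρ x * c) - ρ x + 1 / c)) := by
      apply setIntegral_mono hIw k2
      intro x
      have := pk_pt (mul_pos (hpos x) hc) hl
      have e : |ρ x * c - 1| = c * |ρ x - 1 / c| := by
        rw [← abs_of_pos hc, ← abs_mul, abs_of_pos hc]; congr 1; field_simp
      rw [e] at this
      simp only
      rw [← mul_le_mul_iff_right₀ hc]
      refine this.trans (le_of_eq ?_)
      field_simp
      ring
    rw [integral_add k1 (hP.const_mul _),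
      integral_add (hI1.const_mul _) (hk _), integral_const_mul, integral_const_mul, hPhi, hIc, hint] at this
    refine this.trans (le_of_eq ?_)
    field_simp
    ring
  have ha0 : 0 ≤ a := setIntegral_nonneg (tc_box_meas L d) fun x _ => abs_nonneg _
  rcases ha0.eq_or_lt with h | h
  · rw [← h]
    have h0 : 0 ≤ relEnt L ρ := by
      rw [← hPhi]
      apply setIntegral_nonneg (tc_box_meas L d)
      intro x _
      have hz := mul_pos (hpos x) hc
      have h1 := pk_ineq hz
      have h2 : 0 ≤ ρ x * c * Real.log (ρ x * c) - ρ x * c + 1 := by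
        by_contra hc
        push Not at hc
        nlinarith [sq_nonneg (ρ x * c - 1)]
      have h3 : ρ x * Real.log (ρ x * c) - ρ x + 1 / c = (ρ x * c * Real.log (ρ x * c) - ρ x * c + 1) / c := by
        field_simp
      rw [h3]; positivity
    nlinarith
  · have := key (a / 2) (by linarith)
    have h2 : a / 2 ≤ relEnt L ρ / (2 * (a / 2)) := by linarith
    rw [le_div_iff₀ (by linarith)] at h2
    nlinarith

theorem cv_rw {d : ℕ} (L : ℝ) (f g : (Fin d → ℝ) → ℝ) :
    conv L f g = fun x => ∫ y in box L d, g y * f (x + -y) := by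
  funext x
  unfold conv
  simp_rw [sub_eq_add_neg, mul_comm (f _)]

theorem cv_c1 {d : ℕ} (L : ℝ) {f g : (Fin d → ℝ) → ℝ} (hf : ContDiff ℝ 1 f) (hg : Continuous g) :
    ContDiff ℝ 1 (conv L f g) ∧ ∀ i x, pd i (conv L f g) x = ∫ y in box L d, g y * pd i f (x + -y) := by
  rw [cv_rw]
  exact tc_param (tc_box_compact L d) hf hg continuous_neg

theorem cv_per {d : ℕ} {L : ℝ} {f : (Fin d → ℝ) → ℝ} (g : (Fin d → ℝ) → ℝ) (hf : Per L f) :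
    Per L (conv L f g) := by
  intro x i
  rw [cv_rw]
  simp only
  congr 1
  funext y
  rw [add_right_comm, hf]

theorem cv_div {d : ℕ} {L : ℝ} {D g : (Fin d → ℝ) → ℝ} (hD : ContDiff ℝ 2 D) (hg : Continuous g) (x : Fin d → ℝ) :
    ∑ i, pd i (conv L (pd i D) g) x = ∫ y in box L d, g y * lap D (x + -y) := by
  unfold lap
  simp_rw [Finset.mul_sum]
  rw [integral_finsetSum]
  · exact Finset.sum_congr rfl fun i _ => (cv_c1 L (tc_pd_c1 i hD) hg).2 i x
  · intro i _
    have := tc_pd_cont i (tc_pd_c1 i hD)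
    exact tc_int L (by fun_prop)

theorem cv_lap0 {d : ℕ} {L : ℝ} (hL : 0 < L) {D : (Fin d → ℝ) → ℝ} (hD : ContDiff ℝ 2 D) (hp : Per L D)
    (x : Fin d → ℝ) : ∫ y in box L d, lap D (x + -y) = 0 := by
  unfold lap
  rw [integral_finsetSum]
  · apply Finset.sum_eq_zero
    intro i _
    have h1 := tc_pd_c1 i hD
    have h2 : ContDiff ℝ 1 (fun y => - pd i D (x + -y)) := by fun_prop
    have h3 : ∀ y, pd i (fun y => - pd i D (x + -y)) y = pd i (pd i D) (x + -y) := by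
      intro y
      unfold pd
      have hd : DifferentiableAt ℝ (fun x => fderiv ℝ D x (Pi.single i 1)) (x + -y) :=
        h1.differentiable one_ne_zero _
      have hk : HasFDerivAt (fun y : Fin d → ℝ => x + -y) (-(ContinuousLinearMap.id ℝ (Fin d → ℝ))) y :=
        (hasFDerivAt_id y).neg.const_add x
      have := (hd.hasFDerivAt.comp y hk).neg.fderiv
      simp only [Function.comp_def] at this
      erw [this]
      simp
    have h4 : Per L (fun y => - pd i D (x + -y)) := by
      intro y j
      have := tc_per_pd i hp (x + -(y + L • (Pi.single j 1 : Fin d → ℝ))) j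
      simp only
      rw [← this]
      congr 2
      abel
    rw [← tc_int_pd hL i h2 h4]
    simp_rw [h3]
  · intro i _
    have := tc_pd_cont i (tc_pd_c1 i hD)
    exact tc_int L (by fun_prop)

theorem lap_cont {d : ℕ} {D : (Fin d → ℝ) → ℝ} (hD : ContDiff ℝ 2 D) : Continuous (lap D) := by
  unfold lap
  exact continuous_finsetSum _ fun i _ => tc_pd_cont i (tc_pd_c1 i hD)

theorem cv_inter {d : ℕ} {L M : ℝ} (hL : 0 < L) {D ρ : (Fin d → ℝ) → ℝ} (hD : ContDiff ℝ 2 D) (hp : Per L D)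
    (hM0 : 0 ≤ M) (hM : ∀ x, |lap D x| ≤ M) (hρ : Continuous ρ)
    (hpos : ∀ x, 0 < ρ x) (hint : ∫ x in box L d, ρ x = 1) :
    ∫ x in box L d, ρ x * ∑ i, pd i (conv L (pd i D) ρ) x ≤ 2 * M * relEnt L ρ := by
  have hl := lap_cont hD
  set c := L ^ d with hcdef
  set a := ∫ x in box L d, |ρ x - 1 / c| with ha
  have ha0 : 0 ≤ a := setIntegral_nonneg (tc_box_meas L d) fun x _ => abs_nonneg _
  set V : (Fin d → ℝ) → ℝ := fun x => ∑ i, pd i (conv L (pd i D) ρ) x with hV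
  have hVc : Continuous V := continuous_finsetSum _ fun i _ => tc_pd_cont i (cv_c1 L (tc_pd_c1 i hD) hρ).1
  have hV0 : ∫ x in box L d, V x = 0 := by
    simp only [hV]
    rw [integral_finsetSum]
    · exact Finset.sum_eq_zero fun i _ => tc_int_pd hL i (cv_c1 L (tc_pd_c1 i hD) hρ).1 (cv_per _ (tc_per_pd i hp))
    · intro i _
      exact tc_int L (tc_pd_cont i (cv_c1 L (tc_pd_c1 i hD) hρ).1)
  have hVw : ∀ x, |V x| ≤ M * a := by
    intro x
    have e : V x = ∫ y in box L d, (ρ y - 1 / c) * lap D (x + -y) := by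
      simp only [hV]
      rw [cv_div hD hρ]
      have k1 : Continuous fun y => ρ y * lap D (x + -y) := by fun_prop
      have k2 : Continuous fun y => (1 / c) * lap D (x + -y) := by fun_prop
      simp_rw [sub_mul]
      rw [integral_sub (tc_int L k1) (tc_int L k2), integral_const_mul, cv_lap0 hL hD hp]
      ring
    rw [e]
    refine abs_integral_le_integral_abs.trans ?_
    rw [← integral_const_mul]
    apply setIntegral_mono (tc_int L (by fun_prop)) (tc_int L (by fun_prop))
    intro y
    simp only
    rw [abs_mul, mul_comm]
    exact mul_le_mul_of_nonneg_right (hM _) (abs_nonneg _)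
  have e2 : ∫ x in box L d, ρ x * V x = ∫ x in box L d, (ρ x - 1 / c) * V x := by
    have k1 : Continuous fun x => ρ x * V x := by fun_prop
    have k2 : Continuous fun x => (1 / c) * V x := by fun_prop
    simp_rw [sub_mul]
    rw [integral_sub (tc_int L k1) (tc_int L k2), integral_const_mul, hV0]
    ring
  change ∫ x in box L d, ρ x * V x ≤ _
  rw [e2]
  have : ∫ x in box L d, (ρ x - 1 / c) * V x ≤ (M * a) * a := by
    conv_rhs => rw [ha, ← integral_const_mul]
    apply setIntegral_mono (tc_int L (by fun_prop)) (tc_int L (by fun_prop))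
    intro x
    simp only
    refine (le_abs_self _).trans ?_
    rw [abs_mul, mul_comm]
    exact mul_le_mul_of_nonneg_right (hVw _) (abs_nonneg _)
  have hpk := pinsker hL hρ hpos hint
  nlinarith

theorem diss_der {d : ℕ} {L κ M β : ℝ} {ρ : ℝ → (Fin d → ℝ) → ℝ} {B : ℝ → Fin d → (Fin d → ℝ) → ℝ}
    (S : Sol d L κ M β ρ B) {h g g' : ℝ → ℝ} (hh : ∀ r > 0, ContDiffAt ℝ 1 h r)
    (hg : ∀ r > 0, HasDerivAt h (g r) r) (hgd : ∀ r > 0, ContDiffAt ℝ 1 g r)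
    (hg' : ∀ r > 0, HasDerivAt g (g' r) r) {t : ℝ} (ht : 0 < t) :
    HasDerivWithinAt (fun s => ∫ x in box L d, h (ρ s x))
      (- (∑ i, ∫ x in box L d, g' (ρ t x) * (pd i (ρ t) x) ^ 2) +
      κ * ∫ x in box L d, (ρ t x * g (ρ t x) - h (ρ t x)) * ∑ i, pd i (B t i) x) (Set.Ici t) t := by
  have := box_fin L d
  obtain ⟨C, δ, hδ, hC⟩ := RL_all S ht
  obtain ⟨m, hm, hmρ⟩ := tc_lb S.hL (S.reg t ht).continuous (S.per t ht) (S.pos t ht)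
  obtain ⟨N, hN, hNρ⟩ := tc_bdd S.hL (S.reg t ht).continuous (S.per t ht)
  rw [← ib_diss S.hL (S.reg t ht) (S.per t ht) (S.B1 t ht) (S.Bper t ht)
    (fun x => hh _ (S.pos t ht x)) (fun x => hg _ (S.pos t ht x)) (fun x => hgd _ (S.pos t ht x))
    (fun x => hg' _ (S.pos t ht x))]
  have hgc : ContinuousOn g (Set.Icc (m / 2) (N + 1)) := fun r hr =>
    (hgd r (by linarith [hr.1])).continuousAt.continuousWithinAt
  obtain ⟨K, hK⟩ := isCompact_Icc.exists_bound_of_continuousOn hgc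
  set η := min (m / 2) 1 with hη
  have hη0 : 0 < η := lt_min (by linarith) one_pos
  have hC1 : 0 < |C| + 1 := by positivity
  have hmem : ∀ s ∈ Set.Ico t (t + min δ (η / (|C| + 1))), ∀ x, ρ s x ∈ Set.Icc (m / 2) (N + 1) := by
    intro s hs x
    have h1 := hC s ⟨hs.1, hs.2.trans_le (by gcongr; exact min_le_left _ _)⟩ x
    have h2 : s - t ≤ η / (|C| + 1) := by
      have := hs.2; have := min_le_right δ (η / (|C| + 1)); linarith
    have h3 : |C| * (s - t) ≤ η := by
      rw [le_div_iff₀ hC1] at h2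
      nlinarith [hs.1]
    have h4 : C * (s - t) ≤ |C| * (s - t) := mul_le_mul_of_nonneg_right (le_abs_self _) (by linarith [hs.1])
    have h5 : |ρ s x - ρ t x| ≤ η := by linarith
    have h6 := abs_le.1 h5
    have h7 := min_le_left (m / 2) 1
    have h8 := min_le_right (m / 2) 1
    have h9 := hmρ x
    have h10 := (abs_le.1 (hNρ x)).2
    exact ⟨by linarith [h6.1], by linarith [h6.2]⟩
  have hmin : 0 < min δ (η / (|C| + 1)) := lt_min hδ (by positivity)
  have htt : t ∈ Set.Ico t (t + min δ (η / (|C| + 1))) := ⟨le_rfl, by linarith⟩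
  refine g_rd (C := |K| * |C|) hmin ?_ ?_ ?_
  · intro s hs
    have hs0 : 0 < s := ht.trans_le hs.1
    apply tc_int
    exact continuous_iff_continuousAt.2 fun x =>
      (hh _ (S.pos s hs0 x)).continuousAt.comp (f := ρ s) (S.reg s hs0).continuous.continuousAt
  · intro s hs x
    have h1 := hC s ⟨hs.1, hs.2.trans_le (by gcongr; exact min_le_left _ _)⟩ x
    have h2 := (convex_Icc (m / 2) (N + 1)).norm_image_sub_le_of_norm_hasDerivWithin_le (f := h) (f' := g) (C := |K|)
      (fun r hr => (hg r (by linarith [hr.1])).hasDerivWithinAt) (fun r hr => (hK r hr).trans (le_abs_self _))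
      (hmem t htt x) (hmem s hs x)
    rw [Real.norm_eq_abs, Real.norm_eq_abs] at h2
    have h4 : C * (s - t) ≤ |C| * (s - t) := mul_le_mul_of_nonneg_right (le_abs_self _) (by linarith [hs.1])
    calc _ ≤ _ := h2
      _ ≤ |K| * (|C| * (s - t)) := by gcongr; linarith
      _ = _ := by ring
  · intro x
    exact (hg _ (S.pos t ht x)).comp t (S.pde t ht x)

/-- lower semicontinuity -/
theorem fat {d : ℕ} {L κ M β : ℝ} {ρ : ℝ → (Fin d → ℝ) → ℝ} {B : ℝ → Fin d → (Fin d → ℝ) → ℝ}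
    (S : Sol d L κ M β ρ B) (hpos0 : ∀ x, 0 ≤ ρ 0 x) (hprob0 : ∫ x in box L d, ρ 0 x = 1)
    {h : ℝ → ℝ} (hc : ContinuousOn h (Set.Ici 0)) {A b : ℝ} (hlb : ∀ r, 0 ≤ r → -A - b * r ≤ h r)
    {t : ℝ} (ht : 0 ≤ t) {s : ℕ → ℝ} (hs : ∀ n, 0 < s n) (hst : Filter.Tendsto s Filter.atTop (nhds t))
    {c : ℕ → ℝ} {C : ℝ} (hcC : Filter.Tendsto c Filter.atTop (nhds C))
    (hle : ∀ n, ∫ x in box L d, h (ρ (s n) x) ≤ c n) :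
    IntegrableOn (fun x => h (ρ t x)) (box L d) ∧ ∫ x in box L d, h (ρ t x) ≤ C := by
  have := box_fin L d
  have hnn : ∀ r, 0 ≤ r → ∀ x, 0 ≤ ρ r x := by
    intro r hr x
    rcases hr.eq_or_lt with h | h
    · rw [← h]; exact hpos0 x
    · exact (S.pos r h x).le
  have hpr : ∫ x in box L d, ρ t x = 1 := by
    rcases ht.eq_or_lt with h | h
    · rw [← h]; exact hprob0
    · exact S.prob t h
  have hcs : ∀ n, Continuous (fun x => h (ρ (s n) x)) := fun n =>
    hc.comp_continuous (S.reg _ (hs n)).continuous fun x => hnn _ (hs n).le x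
  refine g_fatou (ρn := fun n => ρ (s n)) (ρ := ρ t) (m := 1) (A := A) (B := b) (fun n => tc_int L (hcs n))
    (fun n => tc_int L (S.reg _ (hs n)).continuous) ?_ (fun n => S.prob _ (hs n)) hpr
    (fun n x => hlb _ (hnn _ (hs n).le x)) ?_ (fun x => sol_seq S ht (fun n => (hs n).le) hst x) hle hcC
  · by_contra hc
    rw [integral_undef hc] at hpr
    exact one_ne_zero hpr.symm
  · intro x
    have h1 := hc (ρ t x) (hnn t ht x)
    refine h1.tendsto.comp (tendsto_nhdsWithin_iff.2 ⟨sol_seq S ht (fun n => (hs n).le) hst x, ?_⟩)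
    exact Filter.Eventually.of_forall fun n => hnn _ (hs n).le x

def ent (c ε r : ℝ) : ℝ := r * Real.log (r * c) - r * Real.log (1 + ε * r)
def ent1 (c ε r : ℝ) : ℝ := Real.log (r * c) - Real.log (1 + ε * r) + (1 + ε * r)⁻¹
def ent2 (ε r : ℝ) : ℝ := (r * (1 + ε * r) ^ 2)⁻¹

theorem ent_d {c ε r : ℝ} (hc : 0 < c) (hε : 0 ≤ ε) (hr : 0 < r) :
    HasDerivAt (ent c ε) (ent1 c ε r) r := by
  have hp : 0 < 1 + ε * r := by positivity
  have h1 : HasDerivAt (fun r : ℝ => r * c) c r := by simpa using (hasDerivAt_id r).mul_const c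
  have h2 : HasDerivAt (fun r : ℝ => 1 + ε * r) ε r := by simpa using ((hasDerivAt_id r).const_mul ε).const_add 1
  have := ((hasDerivAt_id r).mul (h1.log (by positivity))).sub ((hasDerivAt_id r).mul (h2.log hp.ne'))
  refine HasDerivAt.congr_deriv this ?_
  simp only [ent1, id]
  field_simp
  ring

theorem ent_d1 {c ε r : ℝ} (hc : 0 < c) (hε : 0 ≤ ε) (hr : 0 < r) :
    HasDerivAt (ent1 c ε) (ent2 ε r) r := by
  have hp : 0 < 1 + ε * r := by positivity
  have h1 : HasDerivAt (fun r : ℝ => r * c) c r := by simpa using (hasDerivAt_id r).mul_const c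
  have h2 : HasDerivAt (fun r : ℝ => 1 + ε * r) ε r := by simpa using ((hasDerivAt_id r).const_mul ε).const_add 1
  have := ((h1.log (by positivity)).sub (h2.log hp.ne')).add (h2.inv hp.ne')
  refine HasDerivAt.congr_deriv this ?_
  simp only [ent2]
  field_simp
  ring

theorem ent_c1 {c ε r : ℝ} (hc : 0 < c) (hε : 0 ≤ ε) (hr : 0 < r) : ContDiffAt ℝ 1 (ent1 c ε) r := by
  have hp : 1 + ε * r ≠ 0 := by positivity
  have hp2 : r * c ≠ 0 := by positivity
  unfold ent1
  fun_prop (disch := assumption)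

theorem ent_c {c ε r : ℝ} (hc : 0 < c) (hε : 0 ≤ ε) (hr : 0 < r) : ContDiffAt ℝ 1 (ent c ε) r := by
  have hp : 1 + ε * r ≠ 0 := by positivity
  have hp2 : r * c ≠ 0 := by positivity
  unfold ent
  fun_prop (disch := assumption)

theorem ent_cont {c ε : ℝ} (hc : 0 < c) (hε : 0 ≤ ε) : ContinuousOn (ent c ε) (Set.Ici 0) := by
  have h1 : Continuous (fun r : ℝ => r * Real.log (r * c)) := by
    have : (fun r : ℝ => r * Real.log (r * c)) = fun r => (r * c) * Real.log (r * c) * c⁻¹ := by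
      funext r; field_simp
    rw [this]
    exact (Real.continuous_mul_log.comp (continuous_mul_const c)).mul continuous_const
  unfold ent
  refine h1.continuousOn.sub (continuousOn_id.mul (ContinuousOn.log (by fun_prop) ?_))
  intro r hr
  have : (0:ℝ) ≤ r := hr
  positivity

theorem ent_lb {c ε : ℝ} (hc : 0 < c) (hε : 0 ≤ ε) (r : ℝ) (hr : 0 ≤ r) :
    -(1 / c) - (ε / c - 1) * r ≤ ent c ε r := by
  rcases hr.eq_or_lt with h | h
  · subst h; simp [ent]; positivity
  · have hp : 0 < 1 + ε * r := by positivity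
    have hy : 0 < r * c / (1 + ε * r) := by positivity
    have h1 := Real.one_sub_inv_le_log_of_pos hy
    rw [Real.log_div (by positivity) hp.ne'] at h1
    have h2 := mul_le_mul_of_nonneg_left h1 hr
    unfold ent
    rw [← mul_sub]
    refine le_trans (le_of_eq ?_) h2
    field_simp
    ring

theorem ent_ub {c ε : ℝ} (hc : 0 < c) (hε : 0 < ε) (r : ℝ) (hr : 0 ≤ r) :
    ent c ε r ≤ Real.log (c / ε) * r := by
  rcases hr.eq_or_lt with h | h
  · subst h; simp [ent]
  · have hp : 0 < 1 + ε * r := by positivity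
    unfold ent
    rw [← mul_sub, ← Real.log_div (by positivity) hp.ne', mul_comm]
    refine mul_le_mul_of_nonneg_right (Real.log_le_log (by positivity) ?_) hr
    rw [div_le_div_iff₀ hp hε]
    nlinarith

theorem ent_0 (c r : ℝ) : ent c 0 r = r * Real.log (r * c) := by simp [ent]

theorem ent_le {c ε : ℝ} (hε : 0 ≤ ε) (r : ℝ) (hr : 0 ≤ r) :
    ent c ε r ≤ r * Real.log (r * c) := by
  unfold ent
  have : 0 ≤ r * Real.log (1 + ε * r) := mul_nonneg hr (Real.log_nonneg (by nlinarith [mul_nonneg hε hr]))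
  linarith

theorem ent_ge {c ε : ℝ} (hε : 0 ≤ ε) (r : ℝ) (hr : 0 ≤ r) :
    r * Real.log (r * c) ≤ ent c ε r + ε * r * r := by
  unfold ent
  have h0 : 0 ≤ ε * r := mul_nonneg hε hr
  have h1 := Real.log_le_sub_one_of_pos (show 0 < 1 + ε * r by positivity)
  nlinarith

theorem ent_k {c ε r : ℝ} (hε : 0 ≤ ε) (hr : 0 < r) :
    r * ent1 c ε r - ent c ε r = r / (1 + ε * r) := by
  unfold ent ent1
  have hp : 0 < 1 + ε * r := by positivity
  field_simp
  ring

theorem ent_llsc {d : ℕ} {L κ M β : ℝ} {ρ : ℝ → (Fin d → ℝ) → ℝ} {B : ℝ → Fin d → (Fin d → ℝ) → ℝ}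
    (S : Sol d L κ M β ρ B) (hpos0 : ∀ x, 0 ≤ ρ 0 x) (hprob0 : ∫ x in box L d, ρ 0 x = 1)
    {ε a b : ℝ} (hε : 0 ≤ ε) (ha : 0 < a) :
    LLsc (fun t => ∫ x in box L d, ent (L ^ d) ε (ρ t x)) a b := by
  have hc : 0 < L ^ d := pow_pos S.hL d
  intro t ht s hs hst c C hcC hle
  exact (fat S hpos0 hprob0 (ent_cont hc hε) (ent_lb hc hε) (by linarith [ht.1])
    (fun n => ha.trans_le (hs n).1) hst hcC hle).2

theorem ent_grow {d : ℕ} {L κ M β : ℝ} {ρ : ℝ → (Fin d → ℝ) → ℝ} {B : ℝ → Fin d → (Fin d → ℝ) → ℝ}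
    (S : Sol d L κ M β ρ B) (hpos0 : ∀ x, 0 ≤ ρ 0 x) (hprob0 : ∫ x in box L d, ρ 0 x = 1)
    {ε a b : ℝ} (hε : 0 ≤ ε) (ha : 0 < a) (hab : a ≤ b) :
    ∫ x in box L d, ent (L ^ d) ε (ρ b x) ≤ (∫ x in box L d, ent (L ^ d) ε (ρ a x)) + κ * M * (b - a) := by
  have hc : 0 < L ^ d := pow_pos S.hL d
  refine g_lin (F := fun t => ∫ x in box L d, ent (L ^ d) ε (ρ t x)) hab ?_ (ent_llsc S hpos0 hprob0 hε ha)
  intro t ht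
  have ht0 : 0 < t := ha.trans_le ht.1
  refine ⟨_, ?_, diss_der S (fun r hr => ent_c hc hε hr) (fun r hr => ent_d hc hε hr)
    (fun r hr => ent_c1 hc hε hr) (fun r hr => ent_d1 hc hε hr) ht0⟩
  have h1 : 0 ≤ ∑ i, ∫ x in box L d, ent2 ε (ρ t x) * (pd i (ρ t) x) ^ 2 := by
    apply Finset.sum_nonneg
    intro i _
    apply setIntegral_nonneg (tc_box_meas L d)
    intro x _
    have := S.pos t ht0 x
    unfold ent2
    positivity
  have h2 : ∫ x in box L d, (ρ t x * ent1 (L ^ d) ε (ρ t x) - ent (L ^ d) ε (ρ t x)) * ∑ i, pd i (B t i) x ≤ M := by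
    simp_rw [fun x => ent_k (c := L ^ d) hε (S.pos t ht0 x)]
    have hρc := (S.reg t ht0).continuous
    have hV : Continuous fun x => ∑ i, pd i (B t i) x :=
      continuous_finsetSum _ fun i _ => tc_pd_cont i (S.B1 t ht0 i)
    have hp : ∀ x, 0 < 1 + ε * ρ t x := fun x => by have := S.pos t ht0 x; positivity
    have k : Continuous fun x => ρ t x / (1 + ε * ρ t x) * ∑ i, pd i (B t i) x :=
      (hρc.div (by fun_prop) fun x => (hp x).ne').mul hV
    calc _ ≤ ∫ x in box L d, M * ρ t x := by
          apply setIntegral_mono (tc_int L k) (tc_int L (by fun_prop))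
          intro x
          simp only
          have h3 := S.pos t ht0 x
          have h4 := S.Bdiv t ht0 x
          have h5 : ρ t x / (1 + ε * ρ t x) ≤ ρ t x := by
            rw [div_le_iff₀ (hp x)]
            have : 0 ≤ ρ t x * (ε * ρ t x) := by positivity
            linarith
          calc _ ≤ ρ t x / (1 + ε * ρ t x) * M :=
                mul_le_mul_of_nonneg_left ((le_abs_self _).trans h4) (div_nonneg h3.le (hp x).le)
            _ ≤ ρ t x * M := mul_le_mul_of_nonneg_right h5 S.hM
            _ = _ := mul_comm _ _
      _ = M := by rw [integral_const_mul, S.prob t ht0, mul_one]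
  have := mul_le_mul_of_nonneg_left h2 S.hκ.le
  linarith

theorem ent_init {d : ℕ} {L κ M β : ℝ} {ρ : ℝ → (Fin d → ℝ) → ℝ} {B : ℝ → Fin d → (Fin d → ℝ) → ℝ}
    (S : Sol d L κ M β ρ B) (hpos0 : ∀ x, 0 ≤ ρ 0 x) (hprob0 : ∫ x in box L d, ρ 0 x = 1)
    (hH0 : IntegrableOn (fun x => ρ 0 x * Real.log (ρ 0 x * L ^ d)) (box L d)) {t : ℝ} (ht : 0 < t) :
    relEnt L (ρ t) ≤ relEnt L (ρ 0) + κ * M * t := by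
  have hc : 0 < L ^ d := pow_pos S.hL d
  have hρc := (S.reg t ht).continuous
  obtain ⟨N, hN, hNρ⟩ := tc_bdd S.hL hρc (S.per t ht)
  have key : ∀ ε > 0, relEnt L (ρ t) ≤ relEnt L (ρ 0) + κ * M * t + ε * N := by
    intro ε hε
    let s : ℕ → ℝ := fun n => t / ((n : ℝ) + 1)
    have hs0 : ∀ n, 0 < s n := fun n => by simp only [s]; positivity
    have hst : ∀ n, s n ≤ t := fun n => by
      simp only [s]
      exact div_le_self ht.le (by have : (0:ℝ) ≤ n := n.cast_nonneg; linarith)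
    have hs : Filter.Tendsto s Filter.atTop (nhds 0) := by
      have := (tendsto_one_div_add_atTop_nhds_zero_nat (𝕜 := ℝ)).const_mul t
      simpa [s, div_eq_mul_inv] using this
    have hcn : Filter.Tendsto (fun n => -(∫ x in box L d, ent (L ^ d) ε (ρ t x)) + κ * M * (t - s n)) Filter.atTop
        (nhds (-(∫ x in box L d, ent (L ^ d) ε (ρ t x)) + κ * M * (t - 0))) :=
      (((hs.const_sub t).const_mul (κ * M)).const_add _)
    have hF := fat S hpos0 hprob0 (h := fun r => - ent (L ^ d) ε r) (A := 0) (b := Real.log (L ^ d / ε))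
      (ent_cont hc hε.le).neg (fun r hr => by have := ent_ub hc hε r hr; linarith) le_rfl hs0 hs hcn
      (fun n => by
        rw [integral_neg]
        have := ent_grow S hpos0 hprob0 hε.le (hs0 n) (hst n)
        linarith)
    have hint0 : IntegrableOn (fun x => ent (L ^ d) ε (ρ 0 x)) (box L d) := by
      have := hF.1.neg
      simpa [Pi.neg_def] using this
    have h1 := hF.2
    rw [integral_neg] at h1
    have h2 : ∫ x in box L d, ent (L ^ d) ε (ρ 0 x) ≤ relEnt L (ρ 0) :=
      setIntegral_mono hint0 hH0 fun x => ent_le hε.le _ (hpos0 x)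
    have kc : Continuous fun x => ent (L ^ d) ε (ρ t x) :=
      (ent_cont hc hε.le).comp_continuous hρc fun x => (S.pos t ht x).le
    have kc0 : Continuous fun x => ρ t x * Real.log (ρ t x * L ^ d) :=
      hρc.mul ((hρc.mul continuous_const).log fun x => (mul_pos (S.pos t ht x) hc).ne')
    have h3 : relEnt L (ρ t) ≤ ∫ x in box L d, (ent (L ^ d) ε (ρ t x) + ε * N * ρ t x) := by
      apply setIntegral_mono (tc_int L kc0) (tc_int L (kc.add (by fun_prop)))
      intro x
      have h4 := ent_ge (c := L ^ d) hε.le _ (S.pos t ht x).le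
      have h5 : ε * ρ t x * ρ t x ≤ ε * N * ρ t x := by
        have h6 := (le_abs_self _).trans (hNρ x)
        have h7 := (S.pos t ht x).le
        gcongr
      exact h4.trans (by simpa using h5)
    rw [integral_add (tc_int L kc) (tc_int L (by fun_prop)), integral_const_mul, S.prob t ht] at h3
    linarith
  apply le_of_forall_pos_le_add
  intro e he
  have h1 := key (e / (N + 1)) (by positivity)
  have h2 : e / (N + 1) * N ≤ e := by
    rw [div_mul_eq_mul_div, div_le_iff₀ (by positivity)]
    nlinarith
  linarith

theorem ent_decay {d : ℕ} {L κ M β α : ℝ} {ρ : ℝ → (Fin d → ℝ) → ℝ} {B : ℝ → Fin d → (Fin d → ℝ) → ℝ}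
    (S : Sol d L κ M β ρ B) (hpos0 : ∀ x, 0 ≤ ρ 0 x) (hprob0 : ∫ x in box L d, ρ 0 x = 1)
    (hα : α = 4 * π ^ 2 / L ^ 2 - 2 * κ * M)
    (hI : ∀ t > 0, ∫ x in box L d, ρ t x * ∑ i, pd i (B t i) x ≤ 2 * M * relEnt L (ρ t))
    {a b : ℝ} (ha : 0 < a) (hab : a ≤ b) :
    relEnt L (ρ b) ≤ Real.exp (-α * (b - a)) * relEnt L (ρ a) := by
  have hc : 0 < L ^ d := pow_pos S.hL d
  have hr : ∀ t, relEnt L (ρ t) = ∫ x in box L d, ent (L ^ d) 0 (ρ t x) := fun t => by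
    unfold relEnt; simp_rw [ent_0]
  rw [hr, hr]
  refine g_gron (F := fun t => ∫ x in box L d, ent (L ^ d) 0 (ρ t x)) hab ?_ (ent_llsc S hpos0 hprob0 le_rfl ha)
  intro t ht
  have ht0 : 0 < t := ha.trans_le ht.1
  refine ⟨_, ?_, diss_der S (fun r hr => ent_c hc le_rfl hr) (fun r hr => ent_d hc le_rfl hr)
    (fun r hr => ent_c1 hc le_rfl hr) (fun r hr => ent_d1 hc le_rfl hr) ht0⟩
  have h2 := hI t ht0
  have h1 := lsi_main S.hL ((S.reg t ht0).of_le one_le_two) (S.per t ht0) (S.pos t ht0) (S.prob t ht0)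
  simp_rw [fun x => ent_k (c := L ^ d) le_rfl (S.pos t ht0 x)]
  simp only [ent2, zero_mul, add_zero, one_pow, mul_one, div_one]
  rw [← hr]
  have e : ∀ i, ∫ x in box L d, (ρ t x)⁻¹ * (pd i (ρ t) x) ^ 2 = ∫ x in box L d, (pd i (ρ t) x) ^ 2 / ρ t x := by
    intro i; congr 1; funext x; rw [div_eq_mul_inv, mul_comm]
  simp_rw [e]
  set I := ∑ i, ∫ x in box L d, (pd i (ρ t) x) ^ 2 / ρ t x
  set H := relEnt L (ρ t)
  have h3 : 4 * π ^ 2 / L ^ 2 * H ≤ I := by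
    have hL := S.hL
    calc _ ≤ 4 * π ^ 2 / L ^ 2 * ((L / (2 * π)) ^ 2 * I) := by gcongr
      _ = I := by field_simp; ring
  have h4 := mul_le_mul_of_nonneg_left h2 S.hκ.le
  rw [hα]
  linarith

/-- Global exponential stability in relative entropy for classical solutions of the
homogeneous McKean--Vlasov equation `∂t ρ = κ div_x(ρ (∇D ⋆ ρ)) + Δ ρ` on the flat torus,
under the smallness condition `κ < 2π²/(L² ‖ΔD‖_∞)`. -/
theorem homogeneous_mckean_vlasov_entropy_decay
    {d : ℕ} {L κ M : ℝ} (hL : 0 < L) (hκ : 0 < κ)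
    (D : (Fin d → ℝ) → ℝ) (hD : ContDiff ℝ 2 D) (hDper : Per L D)
    (hM : IsLUB ((fun x => |lap D x|) '' box L d) M)
    (ρ : ℝ → (Fin d → ℝ) → ℝ)
    -- classical solution: `ρ ∈ C¹((0,∞); C²(U))`
    (hreg : ∀ t > (0:ℝ), ContDiff ℝ 2 (ρ t))
    (hper : ∀ t > (0:ℝ), Per L (ρ t))
    (hcont : ∀ x, ContinuousOn (fun t => ρ t x) (Set.Ici (0:ℝ)))
    -- `ρ(t,·)` is a strictly positive probability density for `t > 0`
    (hpos : ∀ t > (0:ℝ), ∀ x, 0 < ρ t x)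
    (hprob : ∀ t > (0:ℝ), ∫ x in box L d, ρ t x = 1)
    (hpos0 : ∀ x, 0 ≤ ρ 0 x)
    (hprob0 : ∫ x in box L d, ρ 0 x = 1)
    -- the McKean--Vlasov equation
    (hPDE : ∀ t > (0:ℝ), ∀ x, HasDerivAt (fun s => ρ s x)
      (κ * divg (fun y i => ρ t y * conv L (pd i D) (ρ t) y) x + lap (ρ t) x) t)
    -- finite initial relative entropy
    (hH0 : IntegrableOn (fun x => ρ 0 x * Real.log (ρ 0 x * L ^ d)) (box L d))
    -- smallness of the coupling
    (hκsmall : κ < 2 * π ^ 2 / (L ^ 2 * M)) :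
    0 < 4 * π ^ 2 / L ^ 2 - 2 * κ * M ∧
    ∀ t ≥ (0:ℝ), relEnt L (ρ t) ≤
      Real.exp (-(4 * π ^ 2 / L ^ 2 - 2 * κ * M) * t) * relEnt L (ρ 0) := by
  have hlapPer : Per L (lap D) := fun x i => by
    unfold lap
    exact Finset.sum_congr rfl fun j _ => tc_per_pd j (tc_per_pd j hDper) x i
  have hMx : ∀ x, |lap D x| ≤ M := by
    intro x
    obtain ⟨y, hy, hxy⟩ := tc_reduce hL x
    rw [hxy _ hlapPer]
    exact hM.1 ⟨y, hy, rfl⟩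
  have hM0 : 0 ≤ M := (abs_nonneg _).trans (hMx 0)
  have hMpos : 0 < M := by
    rcases hM0.eq_or_lt with h | h
    · rw [← h, mul_zero, div_zero] at hκsmall
      linarith
    · exact h
  have hα : 0 < 4 * π ^ 2 / L ^ 2 - 2 * κ * M := by
    rw [lt_div_iff₀ (by positivity)] at hκsmall
    rw [sub_pos, lt_div_iff₀ (by positivity)]
    linarith
  refine ⟨hα, ?_⟩
  choose β0 hβ0 hβ using fun i => tc_bdd hL (tc_pd_c1 i hD).continuous (tc_per_pd i hDper)
  have wavg : ∀ t > 0, ∀ (f : (Fin d → ℝ) → ℝ) (K : ℝ), Continuous f → (∀ x, |f x| ≤ K) → ∀ x,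
      |∫ y in box L d, ρ t y * f (x + -y)| ≤ K := by
    intro t ht f K hf hK x
    have hρc := (hreg t ht).continuous
    calc _ ≤ ∫ y in box L d, |ρ t y * f (x + -y)| := abs_integral_le_integral_abs
      _ ≤ ∫ y in box L d, K * ρ t y := by
          apply setIntegral_mono (tc_int L (by fun_prop)) (tc_int L (by fun_prop))
          intro y
          simp only
          rw [abs_mul, abs_of_pos (hpos t ht y), mul_comm]
          exact mul_le_mul_of_nonneg_right (hK _) (hpos t ht y).le
      _ = K := by rw [integral_const_mul, hprob t ht, mul_one]
  have hc1 : ∀ t > (0:ℝ), ∀ i, ContDiff ℝ 1 (conv L (pd i D) (ρ t)) := fun t ht i =>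
    (cv_c1 L (tc_pd_c1 i hD) (hreg t ht).continuous).1
  have S : Sol d L κ M (∑ i, β0 i) ρ (fun t i => conv L (pd i D) (ρ t)) :=
    { hL := hL, hκ := hκ, hM := hM0
      hβ := Finset.sum_nonneg fun i _ => hβ0 i
      reg := hreg, per := hper, cont := hcont, pos := hpos, prob := hprob
      B1 := hc1
      Bper := fun t ht i => cv_per _ (tc_per_pd i hDper)
      Bbd := fun t ht i x => by
        have h1 := wavg t ht (pd i D) (β0 i) (tc_pd_c1 i hD).continuous (hβ i) x
        simp only [cv_rw]
        exact h1.trans (Finset.single_le_sum (f := β0) (fun j _ => hβ0 j) (Finset.mem_univ i))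
      Bdiv := fun t ht x => by
        rw [cv_div hD (hreg t ht).continuous]
        exact wavg t ht _ M (lap_cont hD) hMx x
      pde := fun t ht x => by
        refine (hPDE t ht x).congr_deriv ?_
        unfold divg lap
        congr 2
        refine Finset.sum_congr rfl fun i _ => ?_
        exact tc_pd_mul i ((hreg t ht).differentiable two_ne_zero x) ((hc1 t ht i).differentiable one_ne_zero x) }
  have hI : ∀ t > 0, ∫ x in box L d, ρ t x * ∑ i, pd i (conv L (pd i D) (ρ t)) x ≤ 2 * M * relEnt L (ρ t) :=
    fun t ht => cv_inter hL hD hDper hM0 hMx (hreg t ht).continuous (hpos t ht) (hprob t ht)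
  intro t ht
  rcases ht.eq_or_lt with h | h
  · rw [← h]; simp
  · set α := 4 * π ^ 2 / L ^ 2 - 2 * κ * M with hαd
    have hle : ∀ s ∈ Set.Ioc 0 t, relEnt L (ρ t) ≤ Real.exp (-α * (t - s)) * (relEnt L (ρ 0) + κ * M * s) := by
      intro s hs
      refine (ent_decay S hpos0 hprob0 hαd hI hs.1 hs.2).trans ?_
      exact mul_le_mul_of_nonneg_left (ent_init S hpos0 hprob0 hH0 hs.1) (Real.exp_pos _).le
    have hcts : Continuous fun s => Real.exp (-α * (t - s)) * (relEnt L (ρ 0) + κ * M * s) := by fun_prop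
    have hlim := (hcts.tendsto 0).mono_left (nhdsWithin_le_nhds (s := Set.Ioi 0))
    have := ge_of_tendsto hlim (by
      filter_upwards [Ioc_mem_nhdsGT h] with s hs using hle s hs)
    simpa using this
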